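/- arXiv:1501.00868 — 2 statements merged into one kernel-verified Lean document; each statement's English description precedes it below -/
import Mathlib

section
/- Let {X_n, n ≥ 1} be a strictly stationary sequence of associated random variables with |X_n| ≤ C_1 < ∞ for all n, such that X_1 has a bounded density, and assume Σ_{j=1}^∞ Cov(X_1, X_j)^γ < ∞ for some 0 < γ < 1/6. Let H_n^(2) = (n(n−1)/2)^{'−1} Σ_{1 ≤ i < j ≤ n} h^(2)(X_i, X_j), where h^(2) is the degenerate part of the Gini kernel. Then n^{1/2} H_n^(2) converges to 0 in probability as n → ∞. -/
open MeasureTheory ProbabilityTheory Filter Topology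

noncomputable section

variable {Ω : Type*} [MeasurableSpace Ω]

/-- Covariance of two real-valued random variables. -/
def cov (μ : Measure Ω) (f g : Ω → ℝ) : ℝ :=
  ∫ ω, f ω * g ω ∂μ - (∫ ω, f ω ∂μ) * (∫ ω, g ω ∂μ)

/-- A family of real-valued random variables is *associated* if every two coordinatewise
nondecreasing functions of any finite subcollection have nonnegative covariance
(whenever the relevant integrals exist). -/
def IsAssociated (μ : Measure Ω) {ι : Type*} (X : ι → Ω → ℝ) : Prop :=
  ∀ (S : Finset ι) (h g : (S → ℝ) → ℝ), Monotone h → Monotone g →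
    Measurable h → Measurable g →
    Integrable (fun ω => h fun i => X i ω) μ →
    Integrable (fun ω => g fun i => X i ω) μ →
    Integrable (fun ω => h (fun i => X i ω) * g (fun i => X i ω)) μ →
    0 ≤ cov μ (fun ω => h fun i => X i ω) (fun ω => g fun i => X i ω)

/-- Strict stationarity of the sequence `X 1, X 2, ...`. -/
def StrictStationary (μ : Measure Ω) (X : ℕ → Ω → ℝ) : Prop :=
  ∀ k n : ℕ, Measure.map (fun ω => fun i : Fin n => X (1 + (i : ℕ) + k) ω) μ =
    Measure.map (fun ω => fun i : Fin n => X (1 + (i : ℕ)) ω) μ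

/-- Convergence in distribution to the standard normal law `N(0,1)`. -/
def TendstoStdGaussian (μ : Measure Ω) (Z : ℕ → Ω → ℝ) : Prop :=
  ∀ f : BoundedContinuousFunction ℝ ℝ,
    Tendsto (fun n => ∫ ω, f (Z n ω) ∂μ) atTop
      (𝓝 (∫ x, f x ∂(gaussianReal 0 1)))

/-- `ρ₁(x) = ∫ |x − y| dF(y)` where `F` is the law of `X₁`. -/
def rho1 (μ : Measure Ω) (X1 : Ω → ℝ) (x : ℝ) : ℝ := ∫ y, |x - y| ∂(μ.map X1)

/-- Gini mean difference parameter `θ = ∫∫ |x − y| dF(x) dF(y)`. -/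
def giniTheta (μ : Measure Ω) (X1 : Ω → ℝ) : ℝ := ∫ x, rho1 μ X1 x ∂(μ.map X1)

/-- Degenerate part of the Gini kernel: `h⁽²⁾(x,y) = |x−y| − ρ₁(x) − ρ₁(y) + θ`. -/
def h2 (μ : Measure Ω) (X1 : Ω → ℝ) (x y : ℝ) : ℝ :=
  |x - y| - rho1 μ X1 x - rho1 μ X1 y + giniTheta μ X1

/-- `X` has a bounded probability density (w.r.t. Lebesgue measure). -/
def HasBddDensity (μ : Measure Ω) (X : Ω → ℝ) : Prop :=
  ∃ d : ℝ → ℝ, Measurable d ∧ (∃ M : ℝ, ∀ x, d x ≤ M) ∧ (∀ x, 0 ≤ d x) ∧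
    μ.map X = volume.withDensity (fun x => ENNReal.ofReal (d x))

/-- The degenerate U-statistic `H_n⁽²⁾ = (n(n−1)/2)⁻¹ ∑_{1 ≤ i < j ≤ n} h⁽²⁾(X_i, X_j)`. -/
def H2n (μ : Measure Ω) (X : ℕ → Ω → ℝ) (n : ℕ) (ω : Ω) : ℝ :=
  ((n : ℝ) * ((n : ℝ) - 1) / 2)⁻¹ *
    ∑ i ∈ Finset.Icc 1 n, ∑ j ∈ Finset.Icc (i + 1) n, h2 μ (X 1) (X i ω) (X j ω)

/-- The length of the part of `[-C, x]` lying in the `k`-th cell `[-C + kδ, -C + (k+1)δ]`. -/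
def cellLength (C δ : ℝ) (k : ℕ) (x : ℝ) : ℝ :=
  min (x + C) ((k + 1) * δ) - min (x + C) (k * δ)

lemma continuous_cellLength (C δ : ℝ) (k : ℕ) : Continuous (cellLength C δ k) := by
  unfold cellLength; fun_prop

lemma monotone_cellLength {C δ : ℝ} (hδ : 0 ≤ δ) (k : ℕ) : Monotone (cellLength C δ k) := by
  intro x y hxy
  have h : (k : ℝ) * δ ≤ (k + 1) * δ := by nlinarith
  simp only [cellLength]
  rcases min_cases (x + C) ((k + 1) * δ) with h1 | h1 <;>
  rcases min_cases (x + C) (k * δ) with h2 | h2 <;>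
  rcases min_cases (y + C) ((k + 1) * δ) with h3 | h3 <;>
  rcases min_cases (y + C) (k * δ) with h4 | h4 <;> linarith

lemma monotone_sub_cellLength {C δ : ℝ} (hδ : 0 ≤ δ) (k : ℕ) :
    Monotone fun x => x - cellLength C δ k x := by
  intro x y hxy
  have h : (k : ℝ) * δ ≤ (k + 1) * δ := by nlinarith
  simp only [cellLength]
  rcases min_cases (x + C) ((k + 1) * δ) with h1 | h1 <;>
  rcases min_cases (x + C) (k * δ) with h2 | h2 <;>
  rcases min_cases (y + C) ((k + 1) * δ) with h3 | h3 <;>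
  rcases min_cases (y + C) (k * δ) with h4 | h4 <;> linarith

lemma cellLength_nonneg {δ : ℝ} (hδ : 0 ≤ δ) (C : ℝ) (k : ℕ) (x : ℝ) :
    0 ≤ cellLength C δ k x :=
  sub_nonneg.2 (min_le_min_left _ (by nlinarith))

lemma cellLength_le {δ : ℝ} (hδ : 0 ≤ δ) (C : ℝ) (k : ℕ) (x : ℝ) : cellLength C δ k x ≤ δ := by
  have h : (k : ℝ) * δ ≤ (k + 1) * δ := by nlinarith
  simp only [cellLength]
  rcases min_cases (x + C) ((k + 1) * δ) with h1 | h1 <;>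
  rcases min_cases (x + C) (k * δ) with h2 | h2 <;> linarith

lemma sum_cellLength {C δ : ℝ} {N : ℕ} (hN : N * δ = 2 * C) {x : ℝ} (hx : |x| ≤ C) :
    ∑ k ∈ Finset.range N, cellLength C δ k x = x + C := by
  obtain ⟨h1, h2⟩ := abs_le.1 hx
  have h := Finset.sum_range_sub (fun k : ℕ => min (x + C) (k * δ)) N
  simp only [Nat.cast_add, Nat.cast_one, Nat.cast_zero, zero_mul] at h
  simp only [cellLength]
  rw [h, hN, min_eq_left (by linarith), min_eq_right (by linarith), sub_zero]

lemma sum_cellLength_mul_one_sub_le {δ : ℝ} (hδ : 0 < δ) (C : ℝ) (N : ℕ) {x y : ℝ}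
    (hxy : x ≤ y) :
    ∑ k ∈ Finset.range N, cellLength C δ k x * (1 - cellLength C δ k y / δ) ≤ δ := by
  set f : ℕ → ℝ := fun k => min (max (k * δ - (y + C)) 0) δ with hf
  have hterm : ∀ k ∈ Finset.range N,
      cellLength C δ k x * (1 - cellLength C δ k y / δ) ≤ f (k + 1) - f k := by
    intro k _
    have h : (k : ℝ) * δ ≤ (k + 1) * δ := by nlinarith
    have hmono : f k ≤ f (k + 1) := by
      simp only [hf, Nat.cast_add, Nat.cast_one]
      gcongr
    rcases le_total ((k + 1) * δ) (y + C) with h1 | h1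
    · have : cellLength C δ k y = δ := by
        simp only [cellLength]
        rw [min_eq_right h1, min_eq_right (h.trans h1)]; ring
      rw [this, div_self hδ.ne']
      linarith
    rcases le_total (y + C) (k * δ) with h2 | h2
    · have : cellLength C δ k x = 0 := by
        simp only [cellLength]
        rw [min_eq_left (by linarith), min_eq_left (by linarith), sub_self]
      rw [this]
      linarith
    have e1 : f (k + 1) = (k + 1) * δ - (y + C) := by
      simp only [hf, Nat.cast_add, Nat.cast_one]
      rw [max_eq_left (by linarith), min_eq_left (by linarith)]
    have e2 : f k = 0 := by
      simp only [hf]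
      rw [max_eq_right (by linarith), min_eq_left hδ.le]
    have e3 : cellLength C δ k y = y + C - k * δ := by
      simp only [cellLength]
      rw [min_eq_left h1, min_eq_right h2]
    have h3 := cellLength_le hδ.le C k x
    have h4 : 0 ≤ 1 - cellLength C δ k y / δ :=
      sub_nonneg.2 ((div_le_one hδ).2 (cellLength_le hδ.le C k y))
    calc _ ≤ δ * (1 - cellLength C δ k y / δ) := by gcongr
      _ = δ - cellLength C δ k y := by field_simp
      _ = _ := by rw [e1, e2, e3]; ring
  have h0 : 0 ≤ f 0 := le_min (le_max_right _ _) hδ.le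
  have hN : f N ≤ δ := min_le_right _ _
  have := Finset.sum_le_sum hterm
  rw [Finset.sum_range_sub] at this
  linarith

lemma abs_abs_sub_sub_le {C δ : ℝ} (hδ : 0 < δ) {N : ℕ} (hN : N * δ = 2 * C) {x y : ℝ}
    (hx : |x| ≤ C) (hy : |y| ≤ C) :
    |(|x - y|) - (x + C + (y + C) -
      2 / δ * ∑ k ∈ Finset.range N, cellLength C δ k x * cellLength C δ k y)| ≤ 2 * δ := by
  wlog hxy : x ≤ y generalizing x y
  · have := this hy hx (le_of_not_ge hxy)
    rw [abs_sub_comm x y]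
    simp only [mul_comm (cellLength C δ _ x)]
    rwa [add_comm (x + C)]
  have h1 := sum_cellLength_mul_one_sub_le hδ C N hxy
  have h0 : 0 ≤ ∑ k ∈ Finset.range N, cellLength C δ k x * (1 - cellLength C δ k y / δ) :=
    Finset.sum_nonneg fun k _ => mul_nonneg (cellLength_nonneg hδ.le _ _ _)
      (sub_nonneg.2 ((div_le_one hδ).2 (cellLength_le hδ.le C k y)))
  have e : ∑ k ∈ Finset.range N, cellLength C δ k x * (1 - cellLength C δ k y / δ) =
      x + C - 1 / δ * ∑ k ∈ Finset.range N, cellLength C δ k x * cellLength C δ k y := by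
    rw [← sum_cellLength hN hx, Finset.mul_sum, ← Finset.sum_sub_distrib]
    exact Finset.sum_congr rfl fun k _ => by ring
  rw [e] at h0 h1
  rw [abs_sub_comm x y, abs_of_nonneg (sub_nonneg.2 hxy), abs_le]
  rw [show (2 : ℝ) / δ = 2 * (1 / δ) by ring]
  constructor <;> linarith

lemma integrable_of_abs_le {α : Type*} [MeasurableSpace α] {μ : Measure α} [IsFiniteMeasure μ]
    {f : α → ℝ} (hf : Measurable f) {B : ℝ} (hB : ∀ᵐ a ∂μ, |f a| ≤ B) : Integrable f μ :=
  Integrable.of_bound hf.aestronglyMeasurable B hB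

lemma Continuous.integrable_of_ae_abs_le {ν : Measure ℝ} [IsFiniteMeasure ν] {C : ℝ}
    (hν : ∀ᵐ y ∂ν, |y| ≤ C) {f : ℝ → ℝ} (hf : Continuous f) : Integrable f ν := by
  obtain ⟨B, hB⟩ := (isCompact_Icc (a := -C) (b := C)).exists_bound_of_continuousOn hf.continuousOn
  exact integrable_of_abs_le hf.measurable (hν.mono fun y hy => hB y (abs_le.1 hy))

lemma abs_integral_sub_integral_le {α : Type*} [MeasurableSpace α] {ν : Measure α}
    [IsProbabilityMeasure ν] {f g : α → ℝ} (hf : Integrable f ν) (hg : Integrable g ν) {B : ℝ}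
    (h : ∀ᵐ y ∂ν, |f y - g y| ≤ B) : |∫ y, f y ∂ν - ∫ y, g y ∂ν| ≤ B := by
  rw [← integral_sub hf hg]
  have h' : ∀ᵐ y ∂ν, ‖f y - g y‖ ≤ B := h
  simpa using norm_integral_le_of_norm_le_const h'

lemma le_of_forall_le_add_div {a b c : ℝ} (h : ∀ N : ℕ, 1 ≤ N → a ≤ b + c / N) : a ≤ b := by
  have ht : Tendsto (fun N : ℕ => b + c / (N : ℝ)) atTop (𝓝 (b + 0)) :=
    tendsto_const_nhds.add (tendsto_const_div_atTop_nhds_zero_nat c)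
  rw [add_zero] at ht
  exact ge_of_tendsto ht (eventually_atTop.2 ⟨1, h⟩)

lemma measurable_rho1 (μ : Measure Ω) [IsProbabilityMeasure μ] {X₁ : Ω → ℝ}
    (hX : Measurable X₁) : Measurable (rho1 μ X₁) := by
  have := Measure.isProbabilityMeasure_map (μ := μ) hX.aemeasurable
  have h : StronglyMeasurable (Function.uncurry fun x y : ℝ => |x - y|) := by
    apply Continuous.stronglyMeasurable
    simp only [Function.uncurry_def]
    fun_prop
  exact (h.integral_prod_right (ν := μ.map X₁)).measurable

lemma ae_map_abs_le {μ : Measure Ω} {X₁ : Ω → ℝ} {C : ℝ} (hX : Measurable X₁)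
    (hC : ∀ ω, |X₁ ω| ≤ C) : ∀ᵐ y ∂(μ.map X₁), |y| ≤ C :=
  (ae_map_iff hX.aemeasurable (measurableSet_le (by fun_prop) (by fun_prop))).2
    (Eventually.of_forall hC)

lemma h2_comm (μ : Measure Ω) (X₁ : Ω → ℝ) (x y : ℝ) : h2 μ X₁ x y = h2 μ X₁ y x := by
  unfold h2; rw [abs_sub_comm]; ring

section Kernel

variable {μ : Measure Ω} [IsProbabilityMeasure μ] {X₁ : Ω → ℝ} {C : ℝ}

lemma rho1_mem_Icc (hX : Measurable X₁) (hC : ∀ ω, |X₁ ω| ≤ C) {x : ℝ} (hx : |x| ≤ C) :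
    rho1 μ X₁ x ∈ Set.Icc 0 (2 * C) := by
  have := Measure.isProbabilityMeasure_map (μ := μ) hX.aemeasurable
  refine ⟨integral_nonneg fun _ => abs_nonneg _, ?_⟩
  have h : ∀ᵐ y ∂(μ.map X₁), ‖|x - y|‖ ≤ 2 * C := by
    filter_upwards [ae_map_abs_le hX hC] with y hy
    rw [Real.norm_eq_abs, abs_abs]
    linarith [abs_sub x y]
  simpa [rho1] using (le_abs_self _).trans (norm_integral_le_of_norm_le_const h)

lemma integrable_rho1 (hX : Measurable X₁) (hC : ∀ ω, |X₁ ω| ≤ C) :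
    Integrable (rho1 μ X₁) (μ.map X₁) := by
  have := Measure.isProbabilityMeasure_map (μ := μ) hX.aemeasurable
  refine integrable_of_abs_le (measurable_rho1 μ hX) (B := 2 * C) ?_
  filter_upwards [ae_map_abs_le hX hC] with y hy
  obtain ⟨h0, h1⟩ := rho1_mem_Icc (μ := μ) hX hC hy
  rwa [abs_of_nonneg h0]

lemma giniTheta_mem_Icc (hX : Measurable X₁) (hC : ∀ ω, |X₁ ω| ≤ C) :
    giniTheta μ X₁ ∈ Set.Icc 0 (2 * C) := by
  have := Measure.isProbabilityMeasure_map (μ := μ) hX.aemeasurable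
  have h : ∀ᵐ y ∂(μ.map X₁), rho1 μ X₁ y ∈ Set.Icc 0 (2 * C) :=
    (ae_map_abs_le hX hC).mono fun y hy => rho1_mem_Icc hX hC hy
  refine ⟨integral_nonneg_of_ae (h.mono fun y hy => hy.1), ?_⟩
  simpa [giniTheta] using integral_mono_ae (integrable_rho1 hX hC) (integrable_const (2 * C))
    (h.mono fun y hy => hy.2)

lemma abs_h2_le (hX : Measurable X₁) (hC : ∀ ω, |X₁ ω| ≤ C) {x y : ℝ} (hx : |x| ≤ C)
    (hy : |y| ≤ C) : |h2 μ X₁ x y| ≤ 4 * C := by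
  obtain ⟨a0, a1⟩ := rho1_mem_Icc (μ := μ) hX hC hx
  obtain ⟨b0, b1⟩ := rho1_mem_Icc (μ := μ) hX hC hy
  obtain ⟨c0, c1⟩ := giniTheta_mem_Icc (μ := μ) hX hC
  have h0 := abs_nonneg (x - y)
  have h1 := abs_sub x y
  unfold h2
  rw [abs_le]
  constructor <;> linarith

lemma measurable_h2 (hX : Measurable X₁) :
    Measurable (Function.uncurry (h2 μ X₁)) := by
  have := measurable_rho1 μ hX
  unfold h2 Function.uncurry
  fun_prop

/-- The degenerate Gini kernel is, up to `O(δ)`, minus a finite-rank nonnegative definite kernel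
built from the centered functions `cellLength C δ k`. -/
lemma abs_h2_add_le (hX : Measurable X₁) (hC : ∀ ω, |X₁ ω| ≤ C) {δ : ℝ} (hδ : 0 < δ) {N : ℕ}
    (hN : N * δ = 2 * C) {x y : ℝ} (hx : |x| ≤ C) (hy : |y| ≤ C) :
    |h2 μ X₁ x y + 2 / δ * ∑ k ∈ Finset.range N,
      (cellLength C δ k x - ∫ ω, cellLength C δ k (X₁ ω) ∂μ) *
      (cellLength C δ k y - ∫ ω, cellLength C δ k (X₁ ω) ∂μ)| ≤ 8 * δ := by
  have := Measure.isProbabilityMeasure_map (μ := μ) hX.aemeasurable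
  have hν := ae_map_abs_le (μ := μ) hX hC
  set p : ℕ → ℝ := fun k => ∫ ω, cellLength C δ k (X₁ ω) ∂μ
  have hp' : ∀ k, p k = ∫ y, cellLength C δ k y ∂(μ.map X₁) := fun k =>
    (integral_map hX.aemeasurable (continuous_cellLength C δ k).aestronglyMeasurable).symm
  set m : ℝ := ∫ y, (y + C) ∂(μ.map X₁) with hm
  have hcell : ∀ k, Continuous (cellLength C δ k) := continuous_cellLength C δ
  have icell : ∀ k, Integrable (cellLength C δ k) (μ.map X₁) := fun k =>
    (hcell k).integrable_of_ae_abs_le hν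
  have iid : Integrable (fun y : ℝ => y + C) (μ.map X₁) :=
    Continuous.integrable_of_ae_abs_le hν (by fun_prop)
  have hrho : ∀ z, |z| ≤ C → |rho1 μ X₁ z - (z + C + m -
      2 / δ * ∑ k ∈ Finset.range N, cellLength C δ k z * p k)| ≤ 2 * δ := by
    intro z hz
    have e : ∫ y, (z + C + (y + C) - 2 / δ * ∑ k ∈ Finset.range N,
        cellLength C δ k z * cellLength C δ k y) ∂(μ.map X₁) =
        z + C + m - 2 / δ * ∑ k ∈ Finset.range N, cellLength C δ k z * p k := by
      have iid' : Integrable (fun y : ℝ => z + C + (y + C)) (μ.map X₁) :=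
        (integrable_const _).add iid
      rw [integral_sub iid'
        ((integrable_finsetSum _ fun k _ => (icell k).const_mul _).const_mul _),
        integral_add (integrable_const _) iid, integral_const_mul,
        integral_finsetSum _ fun k _ => (icell k).const_mul _]
      simp only [integral_const_mul, hp', hm]
      simp
    rw [← e]
    refine abs_integral_sub_integral_le (Continuous.integrable_of_ae_abs_le hν (by fun_prop))
      (Continuous.integrable_of_ae_abs_le hν (by fun_prop)) ?_
    filter_upwards [hν] with y hy
    exact abs_abs_sub_sub_le hδ hN hz hy
  have htheta : |giniTheta μ X₁ - (2 * m -
      2 / δ * ∑ k ∈ Finset.range N, p k * p k)| ≤ 2 * δ := by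
    have e : ∫ z, (z + C + m - 2 / δ * ∑ k ∈ Finset.range N,
        cellLength C δ k z * p k) ∂(μ.map X₁) =
        2 * m - 2 / δ * ∑ k ∈ Finset.range N, p k * p k := by
      have iid' : Integrable (fun z : ℝ => z + C + m) (μ.map X₁) :=
        iid.add (integrable_const _)
      rw [integral_sub iid'
        ((integrable_finsetSum _ fun k _ => (icell k).mul_const _).const_mul _),
        integral_add iid (integrable_const _), integral_const_mul,
        integral_finsetSum _ fun k _ => (icell k).mul_const _]
      simp only [integral_mul_const, ← hp', ← hm]
      simp
      ring
    rw [← e]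
    refine abs_integral_sub_integral_le (integrable_rho1 hX hC)
      (Continuous.integrable_of_ae_abs_le hν (by fun_prop)) ?_
    filter_upwards [hν] with y hy
    exact hrho y hy
  have e : ∑ k ∈ Finset.range N, (cellLength C δ k x - p k) * (cellLength C δ k y - p k) =
      ∑ k ∈ Finset.range N, cellLength C δ k x * cellLength C δ k y -
      ∑ k ∈ Finset.range N, cellLength C δ k x * p k -
      ∑ k ∈ Finset.range N, cellLength C δ k y * p k + ∑ k ∈ Finset.range N, p k * p k := by
    rw [← Finset.sum_sub_distrib, ← Finset.sum_sub_distrib, ← Finset.sum_add_distrib]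
    exact Finset.sum_congr rfl fun k _ => by ring
  rw [e]
  have a1 := abs_le.1 (abs_abs_sub_sub_le hδ hN hx hy)
  have a2 := abs_le.1 (hrho x hx)
  have a3 := abs_le.1 (hrho y hy)
  have a4 := abs_le.1 htheta
  unfold h2
  rw [abs_le]
  constructor <;> linarith [a1.1, a1.2, a2.1, a2.2, a3.1, a3.2, a4.1, a4.2]

/-- The degenerate Gini kernel is nonpositive definite. -/
lemma sum_sum_h2_nonpos (hX : Measurable X₁) (hC : ∀ ω, |X₁ ω| ≤ C) (hC0 : 0 < C)
    {ι : Type*} (s : Finset ι) {x : ι → ℝ} (hx : ∀ i ∈ s, |x i| ≤ C) :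
    ∑ i ∈ s, ∑ j ∈ s, h2 μ X₁ (x i) (x j) ≤ 0 := by
  refine le_of_forall_le_add_div (c := 16 * C * s.card * s.card) fun N hN1 => ?_
  have hNpos : (0 : ℝ) < N := by exact_mod_cast hN1
  set δ : ℝ := 2 * C / N with hδdef
  have hδ : 0 < δ := by positivity
  have hN : N * δ = 2 * C := by rw [hδdef]; field_simp
  set p : ℕ → ℝ := fun k => ∫ ω, cellLength C δ k (X₁ ω) ∂μ
  have hle : ∀ i ∈ s, ∀ j ∈ s, h2 μ X₁ (x i) (x j) ≤ 8 * δ - 2 / δ * ∑ k ∈ Finset.range N,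
      (cellLength C δ k (x i) - p k) * (cellLength C δ k (x j) - p k) := by
    intro i hi j hj
    linarith [(abs_le.1 (abs_h2_add_le (μ := μ) hX hC hδ hN (hx i hi) (hx j hj))).2]
  have hsq : ∑ i ∈ s, ∑ j ∈ s, ∑ k ∈ Finset.range N,
      (cellLength C δ k (x i) - p k) * (cellLength C δ k (x j) - p k) =
      ∑ k ∈ Finset.range N, (∑ i ∈ s, (cellLength C δ k (x i) - p k)) ^ 2 := by
    simp only [sq, Finset.sum_mul_sum]
    rw [Finset.sum_comm (s := Finset.range N)]
    exact Finset.sum_congr rfl fun i _ => Finset.sum_comm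
  calc _ ≤ ∑ i ∈ s, ∑ j ∈ s, (8 * δ - 2 / δ * ∑ k ∈ Finset.range N,
      (cellLength C δ k (x i) - p k) * (cellLength C δ k (x j) - p k)) :=
        Finset.sum_le_sum fun i hi => Finset.sum_le_sum fun j hj => hle i hi j hj
    _ = 16 * C * s.card * s.card / N - 2 / δ * ∑ k ∈ Finset.range N,
        (∑ i ∈ s, (cellLength C δ k (x i) - p k)) ^ 2 := by
        simp only [Finset.sum_sub_distrib, ← Finset.mul_sum, hsq]
        simp only [Finset.sum_const, nsmul_eq_mul, hδdef]
        ring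
    _ ≤ _ := by
        rw [zero_add]
        exact sub_le_self _ (mul_nonneg (by positivity)
          (Finset.sum_nonneg fun k _ => sq_nonneg _))

end Kernel

lemma cov_nonneg_of_monotone {μ : Measure Ω} [IsProbabilityMeasure μ] {ι : Type*}
    {X : ι → Ω → ℝ} (hX : IsAssociated μ X) (i j : ι) {f g : ℝ → ℝ} (hf : Monotone f)
    (hg : Monotone g) (hfi : Integrable (fun ω => f (X i ω)) μ)
    (hgi : Integrable (fun ω => g (X j ω)) μ)
    (hfgi : Integrable (fun ω => f (X i ω) * g (X j ω)) μ) :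
    0 ≤ cov μ (fun ω => f (X i ω)) (fun ω => g (X j ω)) := by
  classical
  have hi : i ∈ ({i, j} : Finset ι) := by simp
  have hj : j ∈ ({i, j} : Finset ι) := by simp
  exact hX {i, j} (fun v => f (v ⟨i, hi⟩)) (fun v => g (v ⟨j, hj⟩))
    (fun _ _ h => hf (h _)) (fun _ _ h => hg (h _))
    (hf.measurable.comp (measurable_pi_apply _)) (hg.measurable.comp (measurable_pi_apply _))
    hfi hgi hfgi

lemma cov_sub_left {μ : Measure Ω} {f g h : Ω → ℝ} (hf : Integrable f μ) (hg : Integrable g μ)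
    (hfh : Integrable (fun ω => f ω * h ω) μ) (hgh : Integrable (fun ω => g ω * h ω) μ) :
    cov μ (fun ω => f ω - g ω) h = cov μ f h - cov μ g h := by
  unfold cov
  simp only [sub_mul]
  rw [integral_sub hfh hgh, integral_sub hf hg]
  ring

lemma cov_comm (μ : Measure Ω) (f g : Ω → ℝ) : cov μ f g = cov μ g f := by
  unfold cov
  simp only [mul_comm]

/-- Among associated variables, replacing both arguments by a nondecreasing `1`-Lipschitz
function decreases the covariance. -/
lemma cov_comp_le {μ : Measure Ω} [IsProbabilityMeasure μ] {ι : Type*}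
    {X : ι → Ω → ℝ} (hX : IsAssociated μ X) (hmeas : ∀ i, Measurable (X i)) {i j : ι} {C : ℝ}
    (hi : ∀ ω, |X i ω| ≤ C) (hj : ∀ ω, |X j ω| ≤ C) {f : ℝ → ℝ} (hfc : Continuous f)
    (hf : Monotone f) (hf' : Monotone fun x => x - f x) :
    cov μ (fun ω => f (X i ω)) (fun ω => f (X j ω)) ≤ cov μ (X i) (X j) := by
  obtain ⟨B, hB⟩ := (isCompact_Icc (a := -C) (b := C)).exists_bound_of_continuousOn hfc.continuousOn
  have fi : ∀ ω, |f (X i ω)| ≤ B := fun ω => hB _ (abs_le.1 (hi ω))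
  have fj : ∀ ω, |f (X j ω)| ≤ B := fun ω => hB _ (abs_le.1 (hj ω))
  have m1 : Measurable fun ω => f (X i ω) := hfc.measurable.comp (hmeas i)
  have m2 : Measurable fun ω => f (X j ω) := hfc.measurable.comp (hmeas j)
  have key : ∀ {u v : Ω → ℝ} {A D : ℝ}, Measurable u → Measurable v → (∀ ω, |u ω| ≤ A) →
      (∀ ω, |v ω| ≤ D) → Integrable (fun ω => u ω * v ω) μ := by
    intro u v A D hu hv hA hD
    refine integrable_of_abs_le (hu.mul hv) (B := A * D) (Eventually.of_forall fun ω => ?_)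
    rw [abs_mul]
    exact mul_le_mul (hA ω) (hD ω) (abs_nonneg _) ((abs_nonneg _).trans (hA ω))
  have iXi := integrable_of_abs_le (μ := μ) (hmeas i) (Eventually.of_forall hi)
  have iXj := integrable_of_abs_le (μ := μ) (hmeas j) (Eventually.of_forall hj)
  have ifi : Integrable (fun ω => f (X i ω)) μ :=
    integrable_of_abs_le m1 (Eventually.of_forall fi)
  have ifj : Integrable (fun ω => f (X j ω)) μ :=
    integrable_of_abs_le m2 (Eventually.of_forall fj)
  have kXX := key (hmeas i) (hmeas j) hi hj
  have kfX : Integrable (fun ω => f (X i ω) * X j ω) μ := key m1 (hmeas j) fi hj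
  have kff : Integrable (fun ω => f (X i ω) * f (X j ω)) μ := key m1 m2 fi fj
  have h1 : 0 ≤ cov μ (fun ω => X i ω - f (X i ω)) (X j) :=
    cov_nonneg_of_monotone hX i j hf' monotone_id (iXi.sub ifi) iXj
      ((kXX.sub kfX).congr (Eventually.of_forall fun ω => by simp [sub_mul]))
  have h2 : 0 ≤ cov μ (fun ω => f (X i ω)) (fun ω => X j ω - f (X j ω)) :=
    cov_nonneg_of_monotone hX i j hf hf' ifi (iXj.sub ifj)
      ((kfX.sub kff).congr (Eventually.of_forall fun ω => by simp [mul_sub]))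
  rw [cov_sub_left iXi ifi kXX kfX] at h1
  rw [cov_comm, cov_sub_left iXj ifj (by simpa only [mul_comm] using kfX)
    (by simpa only [mul_comm] using kff), cov_comm, cov_comm μ _ (fun ω => f (X i ω))] at h2
  linarith

lemma StrictStationary.integral_comp_eq {μ : Measure Ω} {X : ℕ → Ω → ℝ}
    (hX : StrictStationary μ X) (hmeas : ∀ j, Measurable (X j)) (k n : ℕ) {F : (Fin n → ℝ) → ℝ}
    (hF : Measurable F) :
    ∫ ω, F (fun i => X (1 + (i : ℕ) + k) ω) ∂μ = ∫ ω, F (fun i => X (1 + (i : ℕ)) ω) ∂μ := by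
  have h1 : Measurable fun ω => fun i : Fin n => X (1 + (i : ℕ) + k) ω :=
    measurable_pi_lambda _ fun i => hmeas _
  have h2 : Measurable fun ω => fun i : Fin n => X (1 + (i : ℕ)) ω :=
    measurable_pi_lambda _ fun i => hmeas _
  rw [← integral_map h1.aemeasurable hF.aestronglyMeasurable, hX k n,
    integral_map h2.aemeasurable hF.aestronglyMeasurable]

lemma StrictStationary.integral_eq {μ : Measure Ω} {X : ℕ → Ω → ℝ}
    (hX : StrictStationary μ X) (hmeas : ∀ j, Measurable (X j)) {i : ℕ} (hi : 1 ≤ i) {f : ℝ → ℝ}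
    (hf : Measurable f) : ∫ ω, f (X i ω) ∂μ = ∫ ω, f (X 1 ω) ∂μ := by
  obtain ⟨k, rfl⟩ := Nat.exists_eq_add_of_le hi
  exact hX.integral_comp_eq hmeas k 1 (F := fun v => f (v 0)) (hf.comp (measurable_pi_apply _))

lemma StrictStationary.cov_eq {μ : Measure Ω} {X : ℕ → Ω → ℝ}
    (hX : StrictStationary μ X) (hmeas : ∀ j, Measurable (X j)) {i : ℕ} (hi : 1 ≤ i) (d : ℕ) :
    cov μ (X i) (X (i + d)) = cov μ (X 1) (X (d + 1)) := by
  unfold cov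
  have e : ∀ l, 1 ≤ l → ∫ ω, X l ω ∂μ = ∫ ω, X 1 ω ∂μ := fun l hl =>
    hX.integral_eq hmeas hl measurable_id'
  rw [e i hi, e (i + d) (by omega), e (d + 1) (by omega)]
  obtain ⟨k, rfl⟩ := Nat.exists_eq_add_of_le hi
  have := hX.integral_comp_eq hmeas k (d + 1) (F := fun v => v 0 * v (Fin.last d)) (by fun_prop)
  simp only [Fin.val_zero, Fin.val_last, add_zero] at this
  rw [add_right_comm, this, add_comm d 1]

section Expectation

variable {μ : Measure Ω} [IsProbabilityMeasure μ] {X : ℕ → Ω → ℝ} {C : ℝ}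

lemma integrable_h2 (hmeas : ∀ j, Measurable (X j)) (hC : ∀ n, 1 ≤ n → ∀ ω, |X n ω| ≤ C)
    {i j : ℕ} (hi : 1 ≤ i) (hj : 1 ≤ j) :
    Integrable (fun ω => h2 μ (X 1) (X i ω) (X j ω)) μ :=
  integrable_of_abs_le ((measurable_h2 (hmeas 1)).comp ((hmeas i).prodMk (hmeas j)))
    (Eventually.of_forall fun ω => abs_h2_le (hmeas 1) (hC 1 le_rfl) (hC i hi ω) (hC j hj ω))

lemma neg_integral_h2_le (hmeas : ∀ j, Measurable (X j)) (hstat : StrictStationary μ X)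
    (hassoc : IsAssociated μ X) (hC : ∀ n, 1 ≤ n → ∀ ω, |X n ω| ≤ C) (hC0 : 0 < C)
    {i j : ℕ} (hi : 1 ≤ i) (hj : 1 ≤ j) {N : ℕ} (hN1 : 1 ≤ N) :
    -∫ ω, h2 μ (X 1) (X i ω) (X j ω) ∂μ ≤
      16 * C / N + N ^ 2 / C * cov μ (X i) (X j) := by
  have hNpos : (0 : ℝ) < N := by exact_mod_cast hN1
  set δ : ℝ := 2 * C / N with hδdef
  have hδ : 0 < δ := by positivity
  have hN : N * δ = 2 * C := by rw [hδdef]; field_simp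
  set p : ℕ → ℝ := fun k => ∫ ω, cellLength C δ k (X 1 ω) ∂μ
  have hcell := continuous_cellLength C δ
  have icell : ∀ k l, Integrable (fun ω => cellLength C δ k (X l ω)) μ := fun k l =>
    integrable_of_abs_le ((hcell k).measurable.comp (hmeas l)) (B := δ)
      (Eventually.of_forall fun ω => by
        rw [abs_of_nonneg (cellLength_nonneg hδ.le _ _ _)]; exact cellLength_le hδ.le _ _ _)
  have icell2 : ∀ k, Integrable
      (fun ω => cellLength C δ k (X i ω) * cellLength C δ k (X j ω)) μ := fun k =>
    integrable_of_abs_le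
      (((hcell k).measurable.comp (hmeas i)).mul ((hcell k).measurable.comp (hmeas j)))
      (B := δ * δ)
      (Eventually.of_forall fun ω => by
        have hi0 := cellLength_nonneg hδ.le C k (X i ω)
        have hj0 := cellLength_nonneg hδ.le C k (X j ω)
        rw [abs_of_nonneg (mul_nonneg hi0 hj0)]
        exact mul_le_mul (cellLength_le hδ.le _ _ _) (cellLength_le hδ.le _ _ _) hj0 hδ.le)
  have iprod : ∀ k, Integrable (fun ω => (cellLength C δ k (X i ω) - p k) *
      (cellLength C δ k (X j ω) - p k)) μ ∧
      ∫ ω, (cellLength C δ k (X i ω) - p k) * (cellLength C δ k (X j ω) - p k) ∂μ =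
        cov μ (fun ω => cellLength C δ k (X i ω)) (fun ω => cellLength C δ k (X j ω)) := by
    intro k
    have e : (fun ω => (cellLength C δ k (X i ω) - p k) * (cellLength C δ k (X j ω) - p k)) =
        fun ω => cellLength C δ k (X i ω) * cellLength C δ k (X j ω) -
          cellLength C δ k (X i ω) * p k - p k * cellLength C δ k (X j ω) + p k * p k := by
      funext ω; ring
    have i1 := (icell2 k).sub ((icell k i).mul_const (p k))
    have i2 := i1.sub ((icell k j).const_mul (p k))
    rw [e]
    refine ⟨i2.add (integrable_const _), ?_⟩
    unfold cov
    have ei : ∫ ω, cellLength C δ k (X i ω) ∂μ = p k :=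
      hstat.integral_eq hmeas hi (hcell k).measurable
    have ej : ∫ ω, cellLength C δ k (X j ω) ∂μ = p k :=
      hstat.integral_eq hmeas hj (hcell k).measurable
    rw [integral_add (by exact i2) (integrable_const _),
      integral_sub (by exact i1) ((icell k j).const_mul (p k)),
      integral_sub (icell2 k) ((icell k i).mul_const (p k)), integral_mul_const,
      integral_const_mul, ei, ej]
    simp
  have hle : ∀ ω, -h2 μ (X 1) (X i ω) (X j ω) ≤ 8 * δ + 2 / δ * ∑ k ∈ Finset.range N,
      (cellLength C δ k (X i ω) - p k) * (cellLength C δ k (X j ω) - p k) := fun ω => by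
    linarith [(abs_le.1 (abs_h2_add_le (μ := μ) (hmeas 1) (hC 1 le_rfl) hδ hN (hC i hi ω)
      (hC j hj ω))).1]
  have iS := (integrable_finsetSum (Finset.range N) fun k _ => (iprod k).1).const_mul (2 / δ)
  rw [← integral_neg]
  calc _ ≤ ∫ ω, (8 * δ + 2 / δ * ∑ k ∈ Finset.range N,
        (cellLength C δ k (X i ω) - p k) * (cellLength C δ k (X j ω) - p k)) ∂μ :=
        integral_mono (integrable_h2 hmeas hC hi hj).neg ((integrable_const _).add iS) hle
    _ = 8 * δ + 2 / δ * ∑ k ∈ Finset.range N,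
        cov μ (fun ω => cellLength C δ k (X i ω)) (fun ω => cellLength C δ k (X j ω)) := by
        rw [integral_add (integrable_const _) iS, integral_const_mul (2 / δ),
          integral_finsetSum _ fun k _ => (iprod k).1]
        simp only [(iprod _).2]
        simp
    _ ≤ 8 * δ + 2 / δ * ∑ k ∈ Finset.range N, cov μ (X i) (X j) := by
        gcongr with k
        exact cov_comp_le hassoc hmeas (hC i hi) (hC j hj) (hcell k)
          (monotone_cellLength hδ.le k) (monotone_sub_cellLength hδ.le k)
    _ = _ := by
        simp only [Finset.sum_const, Finset.card_range, nsmul_eq_mul, hδdef]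
        field_simp
        ring

end Expectation

lemma le_mul_rpow_of_forall_le {t c C γ : ℝ} (hC : 0 < C) (hc : 0 ≤ c) (hγ0 : 0 < γ)
    (hγ : γ ≤ 1 / 3) (ht : t ≤ 4 * C)
    (h : ∀ N : ℕ, 1 ≤ N → t ≤ 16 * C / N + N ^ 2 / C * c) :
    t ≤ (16 * C + 4 / C) * c ^ γ := by
  rcases hc.eq_or_lt with rfl | hc0
  · rw [Real.zero_rpow hγ0.ne', mul_zero]
    exact le_of_forall_le_add_div (c := 16 * C) fun N hN => by simpa using h N hN
  have hC4 : 0 < 4 / C := by positivity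
  rcases le_total 1 c with h1 | h1
  · have : 1 ≤ c ^ γ := Real.one_le_rpow h1 hγ0.le
    nlinarith
  have hpos : 0 < c ^ γ := Real.rpow_pos_of_pos hc0 γ
  have hle1 : c ^ γ ≤ 1 := Real.rpow_le_one hc h1 hγ0.le
  have hinv : 1 ≤ (c ^ γ)⁻¹ := (one_le_inv₀ hpos).2 hle1
  set N := ⌈(c ^ γ)⁻¹⌉₊ with hN
  have hN1 : (c ^ γ)⁻¹ ≤ N := Nat.le_ceil _
  have hN2 : (N : ℝ) ≤ 2 * (c ^ γ)⁻¹ := by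
    linarith [Nat.ceil_lt_add_one (zero_le_one.trans hinv)]
  have hN0 : (0 : ℝ) < N := by linarith
  have hcube : c ≤ (c ^ γ) ^ 3 := by
    rw [← Real.rpow_mul_natCast hc]
    calc c = c ^ (1 : ℝ) := (Real.rpow_one c).symm
      _ ≤ _ := Real.rpow_le_rpow_of_exponent_ge hc0 h1 (by push_cast; linarith)
  have a1 : 16 * C / N ≤ 16 * C * c ^ γ := by
    rw [div_eq_mul_inv]
    gcongr
    exact inv_le_of_inv_le₀ hpos hN1
  have a2 : (N : ℝ) ^ 2 / C * c ≤ 4 / C * c ^ γ := by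
    calc (N : ℝ) ^ 2 / C * c ≤ (2 * (c ^ γ)⁻¹) ^ 2 / C * (c ^ γ) ^ 3 := by gcongr
      _ = _ := by field_simp; ring
  linarith [h N (by exact_mod_cast hN0)]

lemma sum_Icc_sum_Icc_eq {f : ℕ → ℕ → ℝ} (hf : ∀ i j, f i j = f j i) (n : ℕ) :
    ∑ i ∈ Finset.Icc 1 n, ∑ j ∈ Finset.Icc 1 n, f i j =
      2 * ∑ i ∈ Finset.Icc 1 n, ∑ j ∈ Finset.Icc (i + 1) n, f i j +
        ∑ i ∈ Finset.Icc 1 n, f i i := by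
  induction n with
  | zero => simp
  | succ n ih =>
    have e : ∑ i ∈ Finset.Icc 1 n, ∑ j ∈ Finset.Icc (i + 1) (n + 1), f i j =
        ∑ i ∈ Finset.Icc 1 n, (∑ j ∈ Finset.Icc (i + 1) n, f i j + f i (n + 1)) := by
      refine Finset.sum_congr rfl fun i hi => ?_
      rw [Finset.sum_Icc_succ_top (by simp at hi; omega)]
    have e' : ∑ j ∈ Finset.Icc 1 n, f (n + 1) j = ∑ i ∈ Finset.Icc 1 n, f i (n + 1) :=
      Finset.sum_congr rfl fun i _ => hf _ _
    simp only [Finset.sum_Icc_succ_top (Nat.le_add_left 1 n), Finset.sum_add_distrib, e, e', ih,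
      Finset.Icc_eq_empty_of_lt (Nat.lt_succ_self (n + 1)), Finset.sum_empty]
    ring

lemma sum_Icc_sub_le_tsum {a : ℕ → ℝ} (ha : Summable a) (h0 : ∀ m, 0 ≤ a m) (i n : ℕ) :
    ∑ j ∈ Finset.Icc (i + 1) n, a (j - i) ≤ ∑' m, a m := by
  have hinj : Set.InjOn (fun j => j - i) (Finset.Icc (i + 1) n) := by
    intro x hx y hy hxy
    simp only [Finset.coe_Icc, Set.mem_Icc] at hx hy hxy
    omega
  rw [← Finset.sum_image (f := a) hinj]
  exact ha.sum_le_tsum _ fun m _ => h0 m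

/-- The sum over pairs of the degenerate Gini kernel is of order `n` in `L¹`. -/
lemma integral_abs_sum_h2_le {μ : Measure Ω} [IsProbabilityMeasure μ] {X : ℕ → Ω → ℝ} {C γ : ℝ}
    (hmeas : ∀ j, Measurable (X j)) (hstat : StrictStationary μ X)
    (hassoc : IsAssociated μ X) (hC : ∀ n, 1 ≤ n → ∀ ω, |X n ω| ≤ C) (hC0 : 0 < C)
    (hγ0 : 0 < γ) (hγ : γ ≤ 1 / 3)
    (hsum : Summable fun j : ℕ => cov μ (X 1) (X (j + 1)) ^ γ) (n : ℕ) :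
    Integrable (fun ω => ∑ i ∈ Finset.Icc 1 n, ∑ j ∈ Finset.Icc (i + 1) n,
      h2 μ (X 1) (X i ω) (X j ω)) μ ∧
    ∫ ω, |∑ i ∈ Finset.Icc 1 n, ∑ j ∈ Finset.Icc (i + 1) n, h2 μ (X 1) (X i ω) (X j ω)| ∂μ ≤
      n * (4 * C + (16 * C + 4 / C) * ∑' j : ℕ, cov μ (X 1) (X (j + 1)) ^ γ) := by
  set a : ℕ → ℝ := fun j => cov μ (X 1) (X (j + 1)) ^ γ with ha
  set B : ℝ := 16 * C + 4 / C with hB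
  have hB0 : 0 < B := by positivity
  have hX : ∀ l, 1 ≤ l → Integrable (X l) μ := fun l hl =>
    integrable_of_abs_le (hmeas l) (Eventually.of_forall (hC l hl))
  have hc : ∀ m, 0 ≤ cov μ (X 1) (X (m + 1)) := fun m =>
    cov_nonneg_of_monotone hassoc 1 (m + 1) monotone_id monotone_id (hX 1 le_rfl)
      (hX (m + 1) (by omega))
      ((hX (m + 1) (by omega)).bdd_mul (hmeas 1).aestronglyMeasurable
        (Eventually.of_forall (hC 1 le_rfl)))
  have ha0 : ∀ m, 0 ≤ a m := fun m => Real.rpow_nonneg (hc m) _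
  have hint : ∀ i ∈ Finset.Icc 1 n, ∀ j ∈ Finset.Icc (i + 1) n,
      Integrable (fun ω => h2 μ (X 1) (X i ω) (X j ω)) μ := by
    intro i hi j hj
    rw [Finset.mem_Icc] at hi hj
    exact integrable_h2 hmeas hC hi.1 (by omega)
  have hE : ∀ i ∈ Finset.Icc 1 n, ∀ j ∈ Finset.Icc (i + 1) n,
      -∫ ω, h2 μ (X 1) (X i ω) (X j ω) ∂μ ≤ B * a (j - i) := by
    intro i hi j hj
    rw [Finset.mem_Icc] at hi hj
    have hj1 : 1 ≤ j := by omega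
    refine le_mul_rpow_of_forall_le hC0 (hc _) hγ0 hγ ?_ fun N hN => ?_
    · have h : ∀ᵐ ω ∂μ, ‖h2 μ (X 1) (X i ω) (X j ω)‖ ≤ 4 * C := Eventually.of_forall fun ω =>
        abs_h2_le (hmeas 1) (hC 1 le_rfl) (hC i hi.1 ω) (hC j hj1 ω)
      simpa using (neg_le_abs _).trans (norm_integral_le_of_norm_le_const h)
    · rw [← hstat.cov_eq hmeas hi.1 (j - i), Nat.add_sub_cancel' (by omega)]
      exact neg_integral_h2_le hmeas hstat hassoc hC hC0 hi.1 hj1 hN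
  set T : Ω → ℝ := fun ω => ∑ i ∈ Finset.Icc 1 n, ∑ j ∈ Finset.Icc (i + 1) n,
    h2 μ (X 1) (X i ω) (X j ω) with hT
  have iT : Integrable T μ :=
    integrable_finsetSum _ fun i hi => integrable_finsetSum _ fun j hj => hint i hi j hj
  have hET : -∫ ω, T ω ∂μ ≤ n * (B * ∑' j, a j) := by
    rw [hT, integral_finsetSum _ fun i hi => integrable_finsetSum _ fun j hj => hint i hi j hj,
      ← Finset.sum_neg_distrib]
    refine (Finset.sum_le_card_nsmul _ _ (B * ∑' j, a j) fun i hi => ?_).trans_eq (by simp)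
    rw [integral_finsetSum _ fun j hj => hint i hi j hj, ← Finset.sum_neg_distrib]
    refine (Finset.sum_le_sum fun j hj => hE i hi j hj).trans ?_
    rw [← Finset.mul_sum]
    gcongr
    exact sum_Icc_sub_le_tsum hsum ha0 i n
  have habs : ∀ ω, |T ω| ≤ 4 * C * n - T ω := by
    intro ω
    have h1 := sum_sum_h2_nonpos (μ := μ) (hmeas 1) (hC 1 le_rfl) hC0 (Finset.Icc 1 n)
      (x := fun i => X i ω) fun i hi => hC i (Finset.mem_Icc.1 hi).1 ω
    rw [sum_Icc_sum_Icc_eq (fun i j => h2_comm _ _ _ _)] at h1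
    have h2 : (Finset.Icc 1 n).card • (-(4 * C)) ≤
        ∑ i ∈ Finset.Icc 1 n, h2 μ (X 1) (X i ω) (X i ω) :=
      Finset.card_nsmul_le_sum _ _ _ fun i hi => (abs_le.1 (abs_h2_le (hmeas 1) (hC 1 le_rfl)
        (hC i (Finset.mem_Icc.1 hi).1 ω) (hC i (Finset.mem_Icc.1 hi).1 ω))).1
    simp only [Nat.card_Icc, Nat.add_sub_cancel, nsmul_eq_mul] at h2
    have hCn : 0 ≤ C * n := by positivity
    rw [abs_le]
    constructor <;> simp only [hT] <;> linarith
  refine ⟨iT, ?_⟩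
  calc _ ≤ ∫ ω, (4 * C * n - T ω) ∂μ :=
        integral_mono iT.abs ((integrable_const _).sub iT) habs
    _ = 4 * C * n - ∫ ω, T ω ∂μ := by
        rw [integral_sub (integrable_const _) iT]; simp
    _ ≤ _ := by linarith

/-- Display (3.20): `√n · H_n⁽²⁾ → 0` in probability. -/
theorem sqrt_n_H2n_tendsto_zero_in_probability (μ : Measure Ω) [IsProbabilityMeasure μ]
    (X : ℕ → Ω → ℝ) (hmeas : ∀ j, Measurable (X j))
    (hstat : StrictStationary μ X) (hassoc : IsAssociated μ X)
    (C₁ : ℝ) (hbdd : ∀ n : ℕ, 1 ≤ n → ∀ ω, |X n ω| ≤ C₁)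
    (hdens : HasBddDensity μ (X 1))
    (γ : ℝ) (hγ0 : 0 < γ) (hγ : γ < 1 / 6)
    (hsumγ : Summable fun j : ℕ => cov μ (X 1) (X (j + 1)) ^ γ) :
    ∀ ε : ℝ, 0 < ε →
      Tendsto (fun n : ℕ => μ {ω | ε ≤ |Real.sqrt (n : ℝ) * H2n μ X n ω|}) atTop
        (𝓝 0) := by
  intro ε hε
  set C : ℝ := |C₁| + 1 with hCdef
  have hC0 : 0 < C := by positivity
  have hC : ∀ n, 1 ≤ n → ∀ ω, |X n ω| ≤ C := fun n hn ω => by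
    linarith [hbdd n hn ω, le_abs_self C₁]
  set L : ℝ := 4 * C + (16 * C + 4 / C) * ∑' j : ℕ, cov μ (X 1) (X (j + 1)) ^ γ
  have hL := integral_abs_sum_h2_le hmeas hstat hassoc hC hC0 hγ0 (by linarith) hsumγ
  have hbound : ∀ n : ℕ, 2 ≤ n →
      μ {ω | ε ≤ |Real.sqrt (n : ℝ) * H2n μ X n ω|} ≤
        ENNReal.ofReal (4 * L / ε / Real.sqrt n) := by
    intro n hn
    obtain ⟨iT, hT⟩ := hL n
    have hn2 : (2 : ℝ) ≤ n := by exact_mod_cast hn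
    have hs : 0 < Real.sqrt n := Real.sqrt_pos.2 (by linarith)
    have hpos : 0 < (n : ℝ) * ((n : ℝ) - 1) / 2 := by
      have : (0 : ℝ) < n - 1 := by linarith
      positivity
    have hmarkov := mul_meas_ge_le_integral_of_nonneg (μ := μ)
      (f := fun ω => |Real.sqrt (n : ℝ) * H2n μ X n ω|)
      (Eventually.of_forall fun ω => abs_nonneg _) ((iT.const_mul _).const_mul _).abs ε
    have e : ∫ ω, |Real.sqrt (n : ℝ) * H2n μ X n ω| ∂μ =
        Real.sqrt n * ((n : ℝ) * ((n : ℝ) - 1) / 2)⁻¹ *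
          ∫ ω, |∑ i ∈ Finset.Icc 1 n, ∑ j ∈ Finset.Icc (i + 1) n,
            h2 μ (X 1) (X i ω) (X j ω)| ∂μ := by
      rw [← integral_const_mul]
      simp only [H2n, abs_mul, abs_of_pos hs, abs_of_pos (inv_pos.2 hpos), mul_assoc]
    have hL0 : 0 ≤ L := by
      have h0 := (integral_nonneg fun ω => abs_nonneg _).trans hT
      exact nonneg_of_mul_nonneg_right h0 (by linarith)
    have hI : ∫ ω, |Real.sqrt (n : ℝ) * H2n μ X n ω| ∂μ ≤ 4 * L / Real.sqrt n := by
      rw [e]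
      calc _ ≤ Real.sqrt n * ((n : ℝ) * ((n : ℝ) / 2) / 2)⁻¹ * (n * L) := by
            gcongr
            linarith
        _ = 4 * L * Real.sqrt n / n := by field_simp; ring
        _ = 4 * L * Real.sqrt n / (Real.sqrt n * Real.sqrt n) := by
            rw [Real.mul_self_sqrt (by linarith)]
        _ = _ := by field_simp
    rw [← ofReal_measureReal]
    refine ENNReal.ofReal_le_ofReal ?_
    rw [div_right_comm, le_div_iff₀ hε, mul_comm]
    exact hmarkov.trans hI
  have hlim : Tendsto (fun n : ℕ => ENNReal.ofReal (4 * L / ε / Real.sqrt n)) atTop (𝓝 0) := by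
    rw [← ENNReal.ofReal_zero]
    exact ENNReal.tendsto_ofReal (tendsto_const_nhds.div_atTop
      (Real.tendsto_sqrt_atTop.comp tendsto_natCast_atTop_atTop))
  exact tendsto_of_tendsto_of_tendsto_of_le_of_le' tendsto_const_nhds hlim
    (Eventually.of_forall fun _ => zero_le) (eventually_atTop.2 ⟨2, hbound⟩)
end
end

section
/- Let {X_n, n ≥ 1} be a strictly stationary sequence of associated random variables with |X_n| ≤ C_1 < ∞ for all n. Assume 0 < Σ_{j=1}^∞ Cov(X_1, X_j) < ∞ and σ_U² > 0. Then n^{−1/2} Σ_{j=1}^n (ρ_1(X_j) − θ)/σ_U converges in distribution to N(0,1) as n → ∞. -/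
open MeasureTheory ProbabilityTheory Filter Topology

noncomputable section

variable {Ω : Type*} [MeasurableSpace Ω]

lemma cov_eq_covariance {μ : Measure Ω} [IsProbabilityMeasure μ] {f g : Ω → ℝ}
    (hf : MemLp f 2 μ) (hg : MemLp g 2 μ) : cov μ f g = covariance f g μ := by
  rw [covariance_eq_sub hf hg]
  rfl

/-- If `g₁`, `g₂` have increments dominated by those of `v₁`, `v₂`, then, evaluated at associated
variables, the covariance of the former is dominated by that of the latter. -/
lemma IsAssociated.abs_covariance_le {μ : Measure Ω} [IsProbabilityMeasure μ] {ι : Type*}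
    {X : ι → Ω → ℝ} (h : IsAssociated μ X) (S : Finset ι) {g₁ v₁ g₂ v₂ : (S → ℝ) → ℝ}
    (mg₁ : Measurable g₁) (mv₁ : Measurable v₁) (mg₂ : Measurable g₂) (mv₂ : Measurable v₂)
    (d₁ : ∀ x y, x ≤ y → |g₁ y - g₁ x| ≤ v₁ y - v₁ x)
    (d₂ : ∀ x y, x ≤ y → |g₂ y - g₂ x| ≤ v₂ y - v₂ x)
    (lg₁ : MemLp (fun ω => g₁ fun i => X i ω) 2 μ) (lv₁ : MemLp (fun ω => v₁ fun i => X i ω) 2 μ)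
    (lg₂ : MemLp (fun ω => g₂ fun i => X i ω) 2 μ) (lv₂ : MemLp (fun ω => v₂ fun i => X i ω) 2 μ) :
    |covariance (fun ω => g₁ fun i => X i ω) (fun ω => g₂ fun i => X i ω) μ| ≤
      covariance (fun ω => v₁ fun i => X i ω) (fun ω => v₂ fun i => X i ω) μ := by
  have key : ∀ a b : (S → ℝ) → ℝ, Monotone a → Monotone b → Measurable a → Measurable b →
      MemLp (fun ω => a fun i => X i ω) 2 μ → MemLp (fun ω => b fun i => X i ω) 2 μ →
      0 ≤ covariance (fun ω => a fun i => X i ω) (fun ω => b fun i => X i ω) μ := by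
    intro a b ha hb ma mb la lb
    rw [← cov_eq_covariance la lb]
    exact h S a b ha hb ma mb (la.integrable one_le_two) (lb.integrable one_le_two)
      (la.integrable_mul lb)
  have mono_add : ∀ {g v : (S → ℝ) → ℝ}, (∀ x y, x ≤ y → |g y - g x| ≤ v y - v x) →
      Monotone (v + g) := by
    intro g v d x y hxy
    have := (abs_le.1 (d x y hxy)).1
    simp only [Pi.add_apply]
    linarith
  have mono_sub : ∀ {g v : (S → ℝ) → ℝ}, (∀ x y, x ≤ y → |g y - g x| ≤ v y - v x) →
      Monotone (v - g) := by
    intro g v d x y hxy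
    have := (abs_le.1 (d x y hxy)).2
    simp only [Pi.sub_apply]
    linarith
  have hpp := key _ _ (mono_add d₁) (mono_add d₂) (mv₁.add mg₁) (mv₂.add mg₂)
    (lv₁.add lg₁) (lv₂.add lg₂)
  have hmm := key _ _ (mono_sub d₁) (mono_sub d₂) (mv₁.sub mg₁) (mv₂.sub mg₂)
    (lv₁.sub lg₁) (lv₂.sub lg₂)
  have hpm := key _ _ (mono_add d₁) (mono_sub d₂) (mv₁.add mg₁) (mv₂.sub mg₂)
    (lv₁.add lg₁) (lv₂.sub lg₂)
  have hmp := key _ _ (mono_sub d₁) (mono_add d₂) (mv₁.sub mg₁) (mv₂.add mg₂)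
    (lv₁.sub lg₁) (lv₂.add lg₂)
  set G₁ := fun ω => g₁ fun i => X i ω
  set G₂ := fun ω => g₂ fun i => X i ω
  set V₁ := fun ω => v₁ fun i => X i ω
  set V₂ := fun ω => v₂ fun i => X i ω
  change 0 ≤ covariance (V₁ + G₁) (V₂ + G₂) μ at hpp
  change 0 ≤ covariance (V₁ - G₁) (V₂ - G₂) μ at hmm
  change 0 ≤ covariance (V₁ + G₁) (V₂ - G₂) μ at hpm
  change 0 ≤ covariance (V₁ - G₁) (V₂ + G₂) μ at hmp
  rw [covariance_add_left lv₁ lg₁ (lv₂.add lg₂), covariance_add_right lv₁ lv₂ lg₂,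
    covariance_add_right lg₁ lv₂ lg₂] at hpp
  rw [covariance_sub_left lv₁ lg₁ (lv₂.sub lg₂), covariance_sub_right lv₁ lv₂ lg₂,
    covariance_sub_right lg₁ lv₂ lg₂] at hmm
  rw [covariance_add_left lv₁ lg₁ (lv₂.sub lg₂), covariance_sub_right lv₁ lv₂ lg₂,
    covariance_sub_right lg₁ lv₂ lg₂] at hpm
  rw [covariance_sub_left lv₁ lg₁ (lv₂.add lg₂), covariance_add_right lv₁ lv₂ lg₂,
    covariance_add_right lg₁ lv₂ lg₂] at hmp
  rw [abs_le]
  constructor <;> linarith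

/-- A bounded, strictly stationary and associated sequence. -/
structure BddAssocStationary (μ : Measure Ω) (Z : ℕ → Ω → ℝ) (C : ℝ) : Prop where
  measurable : ∀ i, Measurable (Z i)
  bound : ∀ i ω, |Z i ω| ≤ C
  assoc : IsAssociated μ Z
  stationary : ∀ k n : ℕ, Measure.map (fun ω => fun i : Fin n => Z (i + k) ω) μ =
    Measure.map (fun ω => fun i : Fin n => Z i ω) μ

lemma abs_le_of_lipschitz {f : ℝ → ℝ} {L : ℝ} (hf : ∀ x y, |f y - f x| ≤ L * |y - x|) (x : ℝ) :
    |f x| ≤ |f 0| + L * |x| := by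
  have h1 := hf 0 x
  have h2 := abs_sub_abs_le_abs_sub (f x) (f 0)
  rw [sub_zero] at h1
  linarith

lemma continuous_of_abs_sub_le {f : ℝ → ℝ} {L : ℝ} (hL : 0 ≤ L)
    (hf : ∀ x y, |f y - f x| ≤ L * |y - x|) : Continuous f :=
  (LipschitzWith.of_dist_le_mul (K := ⟨L, hL⟩) fun x y => hf y x).continuous

namespace BddAssocStationary

variable {μ : Measure Ω} {Z : ℕ → Ω → ℝ} {C : ℝ}

lemma abs_comp_le (h : BddAssocStationary μ Z C) {f : ℝ → ℝ}
    (hf : ∀ x y, |f y - f x| ≤ |y - x|) (i : ℕ) (ω : Ω) : |f (Z i ω)| ≤ |f 0| + C := by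
  have := abs_le_of_lipschitz (L := 1) (by simpa using hf) (Z i ω)
  linarith [h.bound i ω]

lemma abs_sum_comp_le (h : BddAssocStationary μ Z C) {f : ℝ → ℝ}
    (hf : ∀ x y, |f y - f x| ≤ |y - x|) (A : Finset ℕ) (ω : Ω) :
    |∑ i ∈ A, f (Z i ω)| ≤ A.card * (|f 0| + C) := by
  refine (Finset.abs_sum_le_sum_abs _ _).trans ?_
  refine (Finset.sum_le_sum fun i _ => h.abs_comp_le hf i ω).trans_eq ?_
  simp [mul_add]

lemma measurable_sum_comp (h : BddAssocStationary μ Z C) {f : ℝ → ℝ}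
    (hf : ∀ x y, |f y - f x| ≤ |y - x|) (A : Finset ℕ) :
    Measurable fun ω => ∑ i ∈ A, f (Z i ω) :=
  Finset.measurable_fun_sum _ fun i _ =>
    (continuous_of_abs_sub_le zero_le_one (by simpa using hf)).measurable.comp (h.measurable i)

lemma memLp_comp_sum_comp [IsProbabilityMeasure μ] (h : BddAssocStationary μ Z C) {f p : ℝ → ℝ} {L : ℝ} (hL : 0 ≤ L)
    (hf : ∀ x y, |f y - f x| ≤ |y - x|) (hp : ∀ x y, |p y - p x| ≤ L * |y - x|)
    (A : Finset ℕ) : MemLp (fun ω => p (∑ i ∈ A, f (Z i ω))) 2 μ := by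
  refine MemLp.of_bound ((continuous_of_abs_sub_le hL hp).measurable.comp
    (h.measurable_sum_comp hf A)).aestronglyMeasurable
    (|p 0| + L * (A.card * (|f 0| + C))) (ae_of_all _ fun ω => ?_)
  refine (abs_le_of_lipschitz hp _).trans ?_
  gcongr
  exact h.abs_sum_comp_le hf A ω

lemma memLp_sum_comp [IsProbabilityMeasure μ] (h : BddAssocStationary μ Z C) {f : ℝ → ℝ}
    (hf : ∀ x y, |f y - f x| ≤ |y - x|) (A : Finset ℕ) :
    MemLp (fun ω => ∑ i ∈ A, f (Z i ω)) 2 μ :=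
  h.memLp_comp_sum_comp (p := id) zero_le_one hf (by simp) A

lemma memLp_comp [IsProbabilityMeasure μ] (h : BddAssocStationary μ Z C) {f : ℝ → ℝ}
    (hf : ∀ x y, |f y - f x| ≤ |y - x|) (i : ℕ) : MemLp (fun ω => f (Z i ω)) 2 μ := by
  simpa using h.memLp_sum_comp hf {i}

lemma abs_covariance_comp_sum_le [IsProbabilityMeasure μ] (h : BddAssocStationary μ Z C) {f p q : ℝ → ℝ} {L : ℝ}
    (hL : 0 ≤ L) (hf : ∀ x y, |f y - f x| ≤ |y - x|) (hp : ∀ x y, |p y - p x| ≤ L * |y - x|)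
    (hq : ∀ x y, |q y - q x| ≤ L * |y - x|) (A B : Finset ℕ) :
    |covariance (fun ω => p (∑ i ∈ A, f (Z i ω))) (fun ω => q (∑ i ∈ B, f (Z i ω))) μ| ≤
      L ^ 2 * covariance (fun ω => ∑ i ∈ A, Z i ω) (fun ω => ∑ i ∈ B, Z i ω) μ := by
  have hfm : Measurable f := (continuous_of_abs_sub_le zero_le_one (by simpa using hf)).measurable
  have restrict : ∀ (g : ℝ → ℝ) (D : Finset ℕ), D ⊆ A ∪ B → ∀ ω,
      (∑ i : ↥(A ∪ B), if (i : ℕ) ∈ D then g (Z i ω) else 0) = ∑ i ∈ D, g (Z i ω) := by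
    intro g D hD ω
    rw [Finset.sum_coe_sort (A ∪ B) fun i => if i ∈ D then g (Z i ω) else 0, Finset.sum_ite_mem,
      Finset.inter_eq_right.2 hD]
  have meas : ∀ {g : ℝ → ℝ} (D : Finset ℕ), Measurable g →
      Measurable fun x : ↥(A ∪ B) → ℝ => ∑ i : ↥(A ∪ B), if (i : ℕ) ∈ D then g (x i) else 0 := by
    intro g D hg
    refine Finset.measurable_fun_sum _ fun i _ => ?_
    split_ifs
    · exact hg.comp (measurable_pi_apply i)
    · exact measurable_const
  have incr : ∀ {r : ℝ → ℝ} (D : Finset ℕ), (∀ x y, |r y - r x| ≤ L * |y - x|) →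
      ∀ x y : ↥(A ∪ B) → ℝ, x ≤ y →
      |r (∑ i : ↥(A ∪ B), if (i : ℕ) ∈ D then f (y i) else 0) - r (∑ i : ↥(A ∪ B), if (i : ℕ) ∈ D then f (x i) else 0)| ≤
        L * (∑ i : ↥(A ∪ B), if (i : ℕ) ∈ D then y i else 0) - L * ∑ i : ↥(A ∪ B), if (i : ℕ) ∈ D then x i else 0 := by
    intro r D hr x y hxy
    refine (hr _ _).trans ?_
    rw [← mul_sub, ← Finset.sum_sub_distrib, ← Finset.sum_sub_distrib]
    gcongr
    refine (Finset.abs_sum_le_sum_abs _ _).trans (Finset.sum_le_sum fun i _ => ?_)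
    split_ifs
    · exact (hf _ _).trans_eq (abs_of_nonneg (sub_nonneg.2 (hxy i)))
    · simp
  have hid : ∀ x y : ℝ, |id y - id x| ≤ |y - x| := fun x y => le_rfl
  have main := h.assoc.abs_covariance_le (A ∪ B)
    (g₁ := fun x => p (∑ i : ↥(A ∪ B), if (i : ℕ) ∈ A then f (x i) else 0))
    (v₁ := fun x => L * (∑ i : ↥(A ∪ B), if (i : ℕ) ∈ A then x i else 0))
    (g₂ := fun x => q (∑ i : ↥(A ∪ B), if (i : ℕ) ∈ B then f (x i) else 0))
    (v₂ := fun x => L * (∑ i : ↥(A ∪ B), if (i : ℕ) ∈ B then x i else 0))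
    ((continuous_of_abs_sub_le hL hp).measurable.comp (meas A hfm))
    ((meas A measurable_id).const_mul L)
    ((continuous_of_abs_sub_le hL hq).measurable.comp (meas B hfm))
    ((meas B measurable_id).const_mul L) (incr A hp) (incr B hq)
  simp only [restrict f A Finset.subset_union_left, restrict f B Finset.subset_union_right] at main
  have r1 := restrict id A Finset.subset_union_left
  have r2 := restrict id B Finset.subset_union_right
  simp only [id] at r1 r2
  simp only [r1, r2] at main
  refine (main (h.memLp_comp_sum_comp hL hf hp A) ((h.memLp_sum_comp hid A).const_mul L)
    (h.memLp_comp_sum_comp hL hf hq B) ((h.memLp_sum_comp hid B).const_mul L)).trans_eq ?_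
  rw [covariance_const_mul_left, covariance_const_mul_right]
  ring

lemma covariance_sum_nonneg [IsProbabilityMeasure μ] (h : BddAssocStationary μ Z C) (A B : Finset ℕ) :
    0 ≤ covariance (fun ω => ∑ i ∈ A, Z i ω) (fun ω => ∑ i ∈ B, Z i ω) μ := by
  have := h.abs_covariance_comp_sum_le (f := id) (p := id) (q := id) zero_le_one
    (fun _ _ => le_rfl) (by simp) (by simp) A B
  simpa using (abs_nonneg _).trans this

lemma abs_covariance_comp_le [IsProbabilityMeasure μ] (h : BddAssocStationary μ Z C) {f : ℝ → ℝ}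
    (hf : ∀ x y, |f y - f x| ≤ |y - x|) (i j : ℕ) :
    |covariance (fun ω => f (Z i ω)) (fun ω => f (Z j ω)) μ| ≤ covariance (Z i) (Z j) μ := by
  have := h.abs_covariance_comp_sum_le (f := f) (p := id) (q := id) zero_le_one hf
    (by simp) (by simp) {i} {j}
  simpa using this

lemma integral_stationary (h : BddAssocStationary μ Z C) {E : Type*} [NormedAddCommGroup E]
    [NormedSpace ℝ E] (k n : ℕ) {G : (Fin n → ℝ) → E} (hG : StronglyMeasurable G) :
    ∫ ω, G (fun i => Z (i + k) ω) ∂μ = ∫ ω, G (fun i => Z i ω) ∂μ := by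
  rw [← integral_map (φ := fun ω => fun i : Fin n => Z (i + k) ω)
      (measurable_pi_lambda _ fun i => h.measurable _).aemeasurable hG.aestronglyMeasurable,
    ← integral_map (φ := fun ω => fun i : Fin n => Z i ω)
      (measurable_pi_lambda _ fun i => h.measurable _).aemeasurable hG.aestronglyMeasurable,
    h.stationary k n]

lemma integral_comp (h : BddAssocStationary μ Z C) {f : ℝ → ℝ} (hf : Measurable f) (i : ℕ) :
    ∫ ω, f (Z i ω) ∂μ = ∫ ω, f (Z 0 ω) ∂μ := by
  simpa using h.integral_stationary i 1 (G := fun x => f (x 0))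
    (hf.comp (measurable_pi_apply 0)).stronglyMeasurable

lemma covariance_comp_add (h : BddAssocStationary μ Z C) {f : ℝ → ℝ} (hf : Measurable f)
    (i k : ℕ) :
    covariance (fun ω => f (Z i ω)) (fun ω => f (Z (i + k) ω)) μ =
      covariance (fun ω => f (Z 0 ω)) (fun ω => f (Z k ω)) μ := by
  simp only [covariance, h.integral_comp hf i, h.integral_comp hf (i + k), h.integral_comp hf k]
  have := h.integral_stationary i (k + 1)
    (G := fun x => (f (x 0) - ∫ ω, f (Z 0 ω) ∂μ) * (f (x (Fin.last k)) - ∫ ω, f (Z 0 ω) ∂μ))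
    (((hf.comp (measurable_pi_apply 0)).sub_const _).mul
      ((hf.comp (measurable_pi_apply _)).sub_const _)).stronglyMeasurable
  simpa [add_comm k i] using this

lemma covariance_add (h : BddAssocStationary μ Z C) (i k : ℕ) :
    covariance (Z i) (Z (i + k)) μ = covariance (Z 0) (Z k) μ :=
  h.covariance_comp_add measurable_id i k

lemma covariance_nonneg [IsProbabilityMeasure μ] (h : BddAssocStationary μ Z C) (i j : ℕ) :
    0 ≤ covariance (Z i) (Z j) μ := by
  simpa using h.covariance_sum_nonneg {i} {j}

/-- The total covariance of a block of length `l` with its whole past is bounded by a sum of tails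
of the covariance series. -/
lemma covariance_sum_range_sum_Ico_le [IsProbabilityMeasure μ] (h : BddAssocStationary μ Z C)
    (hsum : Summable fun j => covariance (Z 0) (Z j) μ) (N l : ℕ) :
    covariance (fun ω => ∑ i ∈ Finset.range N, Z i ω) (fun ω => ∑ i ∈ Finset.Ico N (N + l), Z i ω) μ
      ≤ ∑ r ∈ Finset.range l, ∑' k, covariance (Z 0) (Z (k + r + 1)) μ := by
  have hL : ∀ i, MemLp (Z i) 2 μ := h.memLp_comp (f := id) fun _ _ => le_rfl
  rw [covariance_fun_sum_fun_sum' (fun i _ => hL i) (fun i _ => hL i), Finset.sum_comm,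
    Finset.sum_Ico_eq_sum_range, Nat.add_sub_cancel_left]
  refine Finset.sum_le_sum fun r _ => ?_
  rw [← Finset.sum_range_reflect]
  have : ∀ k ∈ Finset.range N, covariance (Z (N - 1 - k)) (Z (N + r)) μ =
      covariance (Z 0) (Z (k + r + 1)) μ := by
    intro k hk
    rw [Finset.mem_range] at hk
    rw [show N + r = (N - 1 - k) + (k + r + 1) by omega, h.covariance_add]
  rw [Finset.sum_congr rfl this]
  refine Summable.sum_le_tsum _ (fun k _ => h.covariance_nonneg _ _) ?_
  simpa [add_assoc] using (summable_nat_add_iff (r + 1)).2 hsum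

lemma norm_charFun_sub_mul_le [IsProbabilityMeasure μ] (h : BddAssocStationary μ Z C) {f : ℝ → ℝ}
    (hf : ∀ x y, |f y - f x| ≤ |y - x|) (u : ℝ) (A B : Finset ℕ) :
    ‖∫ ω, Complex.exp (↑(u * (∑ i ∈ A, f (Z i ω) + ∑ i ∈ B, f (Z i ω))) * Complex.I) ∂μ -
      (∫ ω, Complex.exp (↑(u * ∑ i ∈ A, f (Z i ω)) * Complex.I) ∂μ) *
        ∫ ω, Complex.exp (↑(u * ∑ i ∈ B, f (Z i ω)) * Complex.I) ∂μ‖ ≤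
      4 * u ^ 2 * covariance (fun ω => ∑ i ∈ A, Z i ω) (fun ω => ∑ i ∈ B, Z i ω) μ := by
  have hcos : ∀ x y, |Real.cos (u * y) - Real.cos (u * x)| ≤ |u| * |y - x| := fun x y => by
    rw [← abs_mul, mul_sub]
    exact Real.abs_cos_sub_cos_le _ _
  have hsin : ∀ x y, |Real.sin (u * y) - Real.sin (u * x)| ≤ |u| * |y - x| := fun x y => by
    rw [← abs_mul, mul_sub]
    exact Real.abs_sin_sub_sin_le _ _
  have lc := h.memLp_comp_sum_comp (abs_nonneg u) hf hcos
  have ls := h.memLp_comp_sum_comp (abs_nonneg u) hf hsin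
  have expand : ∀ g : Ω → ℝ, Integrable (fun ω => Real.cos (g ω)) μ →
      Integrable (fun ω => Real.sin (g ω)) μ →
      ∫ ω, Complex.exp (↑(g ω) * Complex.I) ∂μ =
        ↑(∫ ω, Real.cos (g ω) ∂μ) + ↑(∫ ω, Real.sin (g ω) ∂μ) * Complex.I := by
    intro g hc hs
    rw [← integral_complex_ofReal, ← integral_complex_ofReal, ← integral_mul_const,
      ← integral_add hc.ofReal (hs.ofReal.mul_const _)]
    simp only [Complex.exp_mul_I, Complex.ofReal_cos, Complex.ofReal_sin]
  have hcosadd : (fun ω => Real.cos (u * (∑ i ∈ A, f (Z i ω) + ∑ i ∈ B, f (Z i ω)))) =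
      (fun ω => Real.cos (u * ∑ i ∈ A, f (Z i ω))) * (fun ω => Real.cos (u * ∑ i ∈ B, f (Z i ω))) -
      (fun ω => Real.sin (u * ∑ i ∈ A, f (Z i ω))) * (fun ω => Real.sin (u * ∑ i ∈ B, f (Z i ω))) := by
    ext ω
    simp [mul_add, Real.cos_add]
  have hsinadd : (fun ω => Real.sin (u * (∑ i ∈ A, f (Z i ω) + ∑ i ∈ B, f (Z i ω)))) =
      (fun ω => Real.sin (u * ∑ i ∈ A, f (Z i ω))) * (fun ω => Real.cos (u * ∑ i ∈ B, f (Z i ω))) +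
      (fun ω => Real.cos (u * ∑ i ∈ A, f (Z i ω))) * (fun ω => Real.sin (u * ∑ i ∈ B, f (Z i ω))) := by
    ext ω
    simp [mul_add, Real.sin_add]
  have icc := (lc A).integrable_mul (lc B)
  have iss := (ls A).integrable_mul (ls B)
  have isc := (ls A).integrable_mul (lc B)
  have ics := (lc A).integrable_mul (ls B)
  rw [expand _ (by rw [hcosadd]; exact icc.sub iss) (by rw [hsinadd]; exact isc.add ics),
    expand _ ((lc A).integrable one_le_two) ((ls A).integrable one_le_two),
    expand _ ((lc B).integrable one_le_two) ((ls B).integrable one_le_two), hcosadd, hsinadd,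
    integral_sub' icc iss, integral_add' isc ics]
  have bcc := h.abs_covariance_comp_sum_le (abs_nonneg u) hf hcos hcos A B
  have bss := h.abs_covariance_comp_sum_le (abs_nonneg u) hf hsin hsin A B
  have bsc := h.abs_covariance_comp_sum_le (abs_nonneg u) hf hsin hcos A B
  have bcs := h.abs_covariance_comp_sum_le (abs_nonneg u) hf hcos hsin A B
  rw [covariance_eq_sub (lc A) (lc B), sq_abs, abs_le] at bcc
  rw [covariance_eq_sub (ls A) (ls B), sq_abs, abs_le] at bss
  rw [covariance_eq_sub (ls A) (lc B), sq_abs, abs_le] at bsc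
  rw [covariance_eq_sub (lc A) (ls B), sq_abs, abs_le] at bcs
  refine (Complex.norm_le_abs_re_add_abs_im _).trans ?_
  simp only [Complex.sub_re, Complex.add_re, Complex.mul_re, Complex.ofReal_re, Complex.I_re,
    Complex.ofReal_im, Complex.I_im, Complex.sub_im, Complex.add_im, Complex.mul_im, mul_zero,
    mul_one, sub_zero, zero_add, add_zero]
  have : ∀ {a b K : ℝ}, |a| ≤ 2 * K → |b| ≤ 2 * K → |a| + |b| ≤ 4 * K := by
    intros; linarith
  rw [mul_assoc]
  refine this (abs_le.2 ⟨?_, ?_⟩) (abs_le.2 ⟨?_, ?_⟩) <;> linarith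

lemma integrable_exp_sum (h : BddAssocStationary μ Z C) [IsProbabilityMeasure μ] {f : ℝ → ℝ}
    (hf : ∀ x y, |f y - f x| ≤ |y - x|) (u : ℝ) (A : Finset ℕ) :
    Integrable (fun ω => Complex.exp (↑(u * ∑ i ∈ A, f (Z i ω)) * Complex.I)) μ := by
  refine Integrable.of_bound (Measurable.aestronglyMeasurable ?_) 1 (ae_of_all _ fun ω => ?_)
  · have := h.measurable_sum_comp hf A
    fun_prop
  · rw [Complex.norm_exp_ofReal_mul_I]

lemma norm_charFun_le_one [IsProbabilityMeasure μ] (g : Ω → ℝ) :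
    ‖∫ ω, Complex.exp (↑(g ω) * Complex.I) ∂μ‖ ≤ 1 := by
  refine (norm_integral_le_of_norm_le_const (C := 1) (ae_of_all _ fun ω => ?_)).trans (by simp)
  rw [Complex.norm_exp_ofReal_mul_I]

/-- Newman's telescoping estimate: up to a covariance error, the characteristic function of a sum
over `m` consecutive blocks is the `m`-th power of that of a block, hence of any approximation
`β` of the latter. -/
lemma norm_charFun_blocks_sub_pow_le [IsProbabilityMeasure μ] (h : BddAssocStationary μ Z C)
    (hsum : Summable fun j => covariance (Z 0) (Z j) μ) {f : ℝ → ℝ}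
    (hf : ∀ x y, |f y - f x| ≤ |y - x|) (u : ℝ) (l : ℕ) {β : ℂ} (hβ : ‖β‖ ≤ 1) (m : ℕ) :
    ‖∫ ω, Complex.exp (↑(u * ∑ i ∈ Finset.range (m * l), f (Z i ω)) * Complex.I) ∂μ - β ^ m‖ ≤
      m * (4 * u ^ 2 * (∑ r ∈ Finset.range l, ∑' k, covariance (Z 0) (Z (k + r + 1)) μ) +
        ‖∫ ω, Complex.exp (↑(u * ∑ i ∈ Finset.range l, f (Z i ω)) * Complex.I) ∂μ - β‖) := by
  have hfm : Measurable f := (continuous_of_abs_sub_le zero_le_one (by simpa using hf)).measurable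
  induction m with
  | zero => simp
  | succ m ih =>
    have hstep := h.norm_charFun_sub_mul_le hf u (Finset.range (m * l))
      (Finset.Ico (m * l) (m * l + l))
    have hcov := h.covariance_sum_range_sum_Ico_le hsum (m * l) l
    have hblock : ∫ ω, Complex.exp
          (↑(u * ∑ i ∈ Finset.Ico (m * l) (m * l + l), f (Z i ω)) * Complex.I) ∂μ =
        ∫ ω, Complex.exp (↑(u * ∑ i ∈ Finset.range l, f (Z i ω)) * Complex.I) ∂μ := by
      have := h.integral_stationary (m * l) l
        (G := fun x => Complex.exp (↑(u * ∑ i, f (x i)) * Complex.I))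
        (Measurable.stronglyMeasurable (by fun_prop))
      simp only [Finset.sum_Ico_eq_sum_range, Nat.add_sub_cancel_left]
      simpa only [Finset.sum_range, add_comm (m * l)] using this
    have hsplit : ∀ ω, ∑ i ∈ Finset.range ((m + 1) * l), f (Z i ω) =
        ∑ i ∈ Finset.range (m * l), f (Z i ω) +
          ∑ i ∈ Finset.Ico (m * l) (m * l + l), f (Z i ω) := by
      intro ω
      rw [add_mul, one_mul, Finset.sum_range_add_sum_Ico _ (Nat.le_add_right _ _)]
    simp only [hsplit]
    rw [hblock] at hstep
    set a := ∫ ω, Complex.exp (↑(u * ∑ i ∈ Finset.range (m * l), f (Z i ω)) * Complex.I) ∂μ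
    set φ := ∫ ω, Complex.exp (↑(u * ∑ i ∈ Finset.range l, f (Z i ω)) * Complex.I) ∂μ
    set b := ∫ ω, Complex.exp (↑(u * (∑ i ∈ Finset.range (m * l), f (Z i ω) +
          ∑ i ∈ Finset.Ico (m * l) (m * l + l), f (Z i ω))) * Complex.I) ∂μ
    have ha : ‖a‖ ≤ 1 := norm_charFun_le_one _
    have e1 : ‖a * (φ - β)‖ ≤ ‖φ - β‖ := by
      rw [norm_mul]; exact mul_le_of_le_one_left (norm_nonneg _) ha
    have e2 : ‖(a - β ^ m) * β‖ ≤ ‖a - β ^ m‖ := by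
      rw [norm_mul]; exact mul_le_of_le_one_right (norm_nonneg _) hβ
    have e3 := norm_add₃_le (a := b - a * φ) (b := a * (φ - β)) (c := (a - β ^ m) * β)
    rw [show b - a * φ + a * (φ - β) + (a - β ^ m) * β = b - β ^ (m + 1) by ring] at e3
    have e4 := mul_le_mul_of_nonneg_left hcov (show 0 ≤ 4 * u ^ 2 by positivity)
    push_cast
    linarith

lemma tendsto_cesaro_tails :
    Tendsto (fun l : ℕ => (l : ℝ)⁻¹ *
      ∑ r ∈ Finset.range l, ∑' k, covariance (Z 0) (Z (k + r + 1)) μ) atTop (𝓝 0) := by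
  refine Tendsto.cesaro ?_
  exact (tendsto_sum_nat_add fun k => covariance (Z 0) (Z k) μ).comp (tendsto_add_atTop_nat 1)

lemma covariance_sum_range_self [IsProbabilityMeasure μ] (h : BddAssocStationary μ Z C) {f : ℝ → ℝ}
    (hf : ∀ x y, |f y - f x| ≤ |y - x|) (l : ℕ) :
    covariance (fun ω => ∑ i ∈ Finset.range l, f (Z i ω)) (fun ω => ∑ i ∈ Finset.range l, f (Z i ω)) μ
      = ∑ n ∈ Finset.range l, (covariance (fun ω => f (Z 0 ω)) (fun ω => f (Z 0 ω)) μ +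
        2 * ∑ k ∈ Finset.range n, covariance (fun ω => f (Z 0 ω)) (fun ω => f (Z (k + 1) ω)) μ) := by
  have hfm : Measurable f := (continuous_of_abs_sub_le zero_le_one (by simpa using hf)).measurable
  induction l with
  | zero => simp [covariance]
  | succ l ih =>
    have l1 := h.memLp_sum_comp hf (Finset.range l)
    have l2 := h.memLp_comp hf l
    have hcross : covariance (fun ω => ∑ i ∈ Finset.range l, f (Z i ω)) (fun ω => f (Z l ω)) μ =
        ∑ k ∈ Finset.range l, covariance (fun ω => f (Z 0 ω)) (fun ω => f (Z (k + 1) ω)) μ := by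
      rw [covariance_fun_sum_left' (fun i _ => h.memLp_comp hf i) l2, ← Finset.sum_range_reflect]
      refine Finset.sum_congr rfl fun k hk => ?_
      rw [Finset.mem_range] at hk
      obtain ⟨j, rfl⟩ : ∃ j, l = j + (k + 1) := ⟨l - (k + 1), by omega⟩
      rw [show j + (k + 1) - 1 - k = j by omega]
      exact h.covariance_comp_add hfm j (k + 1)
    have hself := h.covariance_comp_add hfm l 0
    rw [add_zero] at hself
    rw [Finset.sum_range_succ _ l, ← ih, ← hcross, ← hself]
    have hsplit : (fun ω => ∑ i ∈ Finset.range (l + 1), f (Z i ω)) =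
        (fun ω => ∑ i ∈ Finset.range l, f (Z i ω)) + fun ω => f (Z l ω) := by
      ext ω
      exact Finset.sum_range_succ _ _
    rw [hsplit, covariance_add_left l1 l2 (l1.add l2), covariance_add_right l1 l1 l2,
      covariance_add_right l2 l1 l2, covariance_comm (fun ω => f (Z l ω))
        (fun ω => ∑ i ∈ Finset.range l, f (Z i ω))]
    ring

lemma tendsto_covariance_sum_div [IsProbabilityMeasure μ] (h : BddAssocStationary μ Z C)
    (hsum : Summable fun j => covariance (Z 0) (Z j) μ) {f : ℝ → ℝ}
    (hf : ∀ x y, |f y - f x| ≤ |y - x|) :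
    Tendsto (fun l : ℕ => (l : ℝ)⁻¹ * covariance (fun ω => ∑ i ∈ Finset.range l, f (Z i ω))
        (fun ω => ∑ i ∈ Finset.range l, f (Z i ω)) μ) atTop
      (𝓝 (covariance (fun ω => f (Z 0 ω)) (fun ω => f (Z 0 ω)) μ +
        2 * ∑' k, covariance (fun ω => f (Z 0 ω)) (fun ω => f (Z (k + 1) ω)) μ)) := by
  simp only [h.covariance_sum_range_self hf]
  refine Tendsto.cesaro (Tendsto.const_add _ (Tendsto.const_mul _ ?_))
  refine (Summable.of_norm_bounded ((summable_nat_add_iff 1).2 hsum) fun k => ?_).hasSum.tendsto_sum_nat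
  exact h.abs_covariance_comp_le hf 0 (k + 1)

end BddAssocStationary

variable {μ : Measure Ω} {Z : ℕ → Ω → ℝ} {C : ℝ}

/-- Second order expansion of the characteristic function of a bounded centred variable, compared
with the Gaussian of the same variance. -/
lemma norm_charFun_sub_gaussian_le [IsProbabilityMeasure μ] {S : Ω → ℝ} (hS : Measurable S) {M : ℝ}
    (hM : ∀ ω, |S ω| ≤ M) (h0 : ∫ ω, S ω ∂μ = 0) {u : ℝ} (hu : |u| * M ≤ 1) :
    ‖∫ ω, Complex.exp (↑(u * S ω) * Complex.I) ∂μ -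
      Complex.exp (((-(u ^ 2 * covariance S S μ / 2) : ℝ) : ℂ))‖ ≤
      (|u| * M) ^ 3 + (u ^ 2 * covariance S S μ) ^ 2 := by
  have hL : MemLp S 2 μ := MemLp.of_bound hS.aestronglyMeasurable M (ae_of_all _ hM)
  have hV : covariance S S μ = ∫ ω, S ω ^ 2 ∂μ := by
    simp [covariance, h0, sq]
  have hi := hL.integrable one_le_two
  have hi2 : Integrable (fun ω => S ω ^ 2) μ := hL.integrable_sq
  have hV0 : 0 ≤ covariance S S μ := hV ▸ integral_nonneg fun ω => sq_nonneg _
  have hM0 : ∀ ω, |u * S ω| ≤ |u| * M := fun ω => by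
    rw [abs_mul]
    exact mul_le_mul_of_nonneg_left (hM ω) (abs_nonneg u)
  have hV1 : u ^ 2 * covariance S S μ ≤ 1 := by
    rw [hV, ← integral_const_mul]
    calc ∫ ω, u ^ 2 * S ω ^ 2 ∂μ ≤ ∫ _, (1 : ℝ) ∂μ := by
          refine integral_mono (hi2.const_mul _) (integrable_const _) fun ω => ?_
          show u ^ 2 * S ω ^ 2 ≤ 1
          rw [← mul_pow, ← sq_abs]
          exact pow_le_one₀ (abs_nonneg _) ((hM0 ω).trans hu)
      _ = 1 := by simp
  set V := covariance S S μ
  have hquad : ∫ ω, (1 + ↑(u * S ω) * Complex.I - (((u * S ω) ^ 2 / 2 : ℝ) : ℂ) : ℂ) ∂μ =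
      1 - ((u ^ 2 * V / 2 : ℝ) : ℂ) := by
    have e : ∀ ω, (1 + ↑(u * S ω) * Complex.I - (((u * S ω) ^ 2 / 2 : ℝ) : ℂ) : ℂ) =
        (1 + ↑(S ω) * (u * Complex.I)) - ↑(S ω ^ 2) * (u ^ 2 / 2) := fun ω => by
      push_cast; ring
    simp only [e]
    rw [integral_sub ((integrable_const _).add (hi.ofReal.mul_const _)) (hi2.ofReal.mul_const _),
      integral_add (integrable_const _) (hi.ofReal.mul_const _), integral_mul_const,
      integral_mul_const, integral_complex_ofReal, integral_complex_ofReal, h0, ← hV]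
    simp
    ring
  have hexp : Integrable (fun ω => Complex.exp (↑(u * S ω) * Complex.I)) μ := by
    refine Integrable.of_bound (Measurable.aestronglyMeasurable (by fun_prop)) 1
      (ae_of_all _ fun ω => ?_)
    rw [Complex.norm_exp_ofReal_mul_I]
  have hquadi : Integrable (fun ω => (1 + ↑(u * S ω) * Complex.I - (((u * S ω) ^ 2 / 2 : ℝ) : ℂ) : ℂ)) μ := by
    refine ((integrable_const _).add ((hi.const_mul u).ofReal.mul_const _)).sub ?_
    simp only [mul_pow]
    exact ((hi2.const_mul _).div_const _).ofReal
  have h1 : ‖∫ ω, Complex.exp (↑(u * S ω) * Complex.I) ∂μ - (1 - ((u ^ 2 * V / 2 : ℝ) : ℂ))‖ ≤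
      (|u| * M) ^ 3 := by
    rw [← hquad, ← integral_sub hexp hquadi]
    refine (norm_integral_le_of_norm_le_const (C := (|u| * M) ^ 3)
      (ae_of_all _ fun ω => ?_)).trans (by simp)
    have hn : ‖(↑(u * S ω) * Complex.I : ℂ)‖ = |u * S ω| := by simp
    have hb := Complex.exp_bound (x := ↑(u * S ω) * Complex.I) (n := 3)
      (by rw [hn]; exact (hM0 ω).trans hu) (by norm_num)
    have hs : ∑ m ∈ Finset.range 3, (↑(u * S ω) * Complex.I : ℂ) ^ m / (m.factorial : ℂ) =
        1 + ↑(u * S ω) * Complex.I - (((u * S ω) ^ 2 / 2 : ℝ) : ℂ) := by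
      simp only [Finset.sum_range_succ, Finset.range_zero, Finset.sum_empty, mul_pow, Complex.I_sq]
      simp [Nat.factorial]
      ring
    rw [hs, hn] at hb
    refine hb.trans ((mul_le_of_le_one_right (by positivity) ?_).trans
      (pow_le_pow_left₀ (abs_nonneg _) (hM0 ω) 3))
    norm_num [Nat.factorial]
  have h2 : ‖(1 - ((u ^ 2 * V / 2 : ℝ) : ℂ) : ℂ) - Complex.exp (((-(u ^ 2 * V / 2) : ℝ) : ℂ))‖ ≤
      (u ^ 2 * V) ^ 2 := by
    have hn : ‖((-(u ^ 2 * V / 2) : ℝ) : ℂ)‖ = u ^ 2 * V / 2 := by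
      rw [Complex.norm_real, norm_neg, Real.norm_eq_abs, abs_of_nonneg (by positivity)]
    have := Complex.norm_exp_sub_one_sub_id_le (x := ((-(u ^ 2 * V / 2) : ℝ) : ℂ))
      (by rw [hn]; linarith)
    rw [hn] at this
    rw [norm_sub_rev]
    refine le_trans (le_of_eq ?_) (this.trans ?_)
    · congr 1
      push_cast
      ring
    · gcongr
      have : 0 ≤ u ^ 2 * V := by positivity
      linarith
  exact (norm_sub_le_norm_sub_add_norm_sub _ _ _).trans (add_le_add h1 h2)

lemma norm_exp_ofReal_mul_I_sub_le (x y : ℝ) :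
    ‖Complex.exp (↑x * Complex.I) - Complex.exp (↑y * Complex.I)‖ ≤ |x - y| := by
  have : Complex.exp (↑x * Complex.I) - Complex.exp (↑y * Complex.I) =
      Complex.exp (↑y * Complex.I) * (Complex.exp (Complex.I * ↑(x - y)) - 1) := by
    rw [mul_sub, ← Complex.exp_add, mul_one]
    congr 2
    push_cast
    ring
  rw [this, norm_mul, Complex.norm_exp_ofReal_mul_I, one_mul]
  exact Real.norm_exp_I_mul_ofReal_sub_one_le

/-- A limit criterion for a sequence approximated with an error having two parameters. -/
lemma tendsto_of_forall_eventually_norm_sub_le {a : ℕ → ℂ} {b : ℂ} {c : ℕ → ℝ} {r : ℕ → ℕ → ℝ}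
    (hc : Tendsto c atTop (𝓝 0)) (hr : ∀ l, 1 ≤ l → Tendsto (r l) atTop (𝓝 0))
    (hab : ∀ l, 1 ≤ l → ∀ᶠ n in atTop, ‖a n - b‖ ≤ r l n + c l) : Tendsto a atTop (𝓝 b) := by
  rw [Metric.tendsto_atTop']
  intro ε hε
  obtain ⟨l, hl1, hl⟩ := ((eventually_ge_atTop 1).and
    (hc.eventually_lt_const (half_pos hε))).exists
  obtain ⟨N, hN⟩ := eventually_atTop.1 ((hab l hl1).and
    ((hr l hl1).eventually_lt_const (half_pos hε)))
  refine ⟨N, fun n hn => ?_⟩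
  rw [dist_eq_norm]
  linarith [(hN n hn.le).1, (hN n hn.le).2]

lemma tendsto_natDiv_div (l : ℕ) (hl : 1 ≤ l) :
    Tendsto (fun n : ℕ => ((n / l : ℕ) : ℝ) / n) atTop (𝓝 (l : ℝ)⁻¹) := by
  have := (tendsto_nat_floor_mul_div_atTop (R := ℝ) (a := (l : ℝ)⁻¹) (by positivity)).comp
    tendsto_natCast_atTop_atTop
  refine this.congr fun n => ?_
  simp only [Function.comp_apply]
  rw [← Nat.floor_div_eq_div (K := ℝ), inv_mul_eq_div]

namespace BddAssocStationary

/-- Newman's central limit theorem for 1-Lipschitz functions of a bounded, strictly stationary,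
associated sequence, at the level of characteristic functions. -/
lemma tendsto_charFun [IsProbabilityMeasure μ] (h : BddAssocStationary μ Z C)
    (hsum : Summable fun j => covariance (Z 0) (Z j) μ) {f : ℝ → ℝ}
    (hf : ∀ x y, |f y - f x| ≤ |y - x|) (h0 : ∫ ω, f (Z 0 ω) ∂μ = 0) {σ2 : ℝ}
    (hσ : σ2 = covariance (fun ω => f (Z 0 ω)) (fun ω => f (Z 0 ω)) μ +
      2 * ∑' k, covariance (fun ω => f (Z 0 ω)) (fun ω => f (Z (k + 1) ω)) μ) (a : ℝ) :
    Tendsto (fun n : ℕ => ∫ ω, Complex.exp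
        (↑(a / √n * ∑ i ∈ Finset.range n, f (Z i ω)) * Complex.I) ∂μ) atTop
      (𝓝 (Complex.exp ((-(a ^ 2 * σ2 / 2) : ℝ) : ℂ))) := by
  have hfm : Measurable f := (continuous_of_abs_sub_le zero_le_one (by simpa using hf)).measurable
  set B := |f 0| + C
  set D : ℕ → ℝ := fun l => ∑ r ∈ Finset.range l, ∑' k, covariance (Z 0) (Z (k + r + 1)) μ
  set V : ℕ → ℝ := fun l => covariance (fun ω => ∑ i ∈ Finset.range l, f (Z i ω))
    (fun ω => ∑ i ∈ Finset.range l, f (Z i ω)) μ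
  have hV0 : ∀ l, 0 ≤ V l := fun l => by
    simp only [V, covariance]
    exact integral_nonneg fun ω => mul_self_nonneg _
  have hD0 : ∀ l, 0 ≤ D l := fun l => Finset.sum_nonneg fun r _ => tsum_nonneg fun k =>
    h.covariance_nonneg _ _
  have hVlim : Tendsto (fun l : ℕ => (l : ℝ)⁻¹ * V l) atTop (𝓝 σ2) :=
    hσ ▸ h.tendsto_covariance_sum_div hsum hf
  have hDlim : Tendsto (fun l : ℕ => (l : ℝ)⁻¹ * D l) atTop (𝓝 0) := tendsto_cesaro_tails
  have hcont : Continuous fun x : ℝ => Complex.exp ((-(a ^ 2 * x / 2) : ℝ) : ℂ) := by fun_prop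
  have hsqrt : Tendsto (fun n : ℕ => (√(n : ℝ))⁻¹) atTop (𝓝 0) :=
    tendsto_inv_atTop_zero.comp (Real.tendsto_sqrt_atTop.comp tendsto_natCast_atTop_atTop)
  refine tendsto_of_forall_eventually_norm_sub_le
    (c := fun l => 4 * a ^ 2 * ((l : ℝ)⁻¹ * D l) +
      ‖Complex.exp ((-(a ^ 2 * ((l : ℝ)⁻¹ * V l) / 2) : ℝ) : ℂ) - Complex.exp ((-(a ^ 2 * σ2 / 2) : ℝ) : ℂ)‖)
    (r := fun l n => |a| * (l * B) * (√(n : ℝ))⁻¹ +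
      ((|a| * (l * B)) ^ 3 * (√(n : ℝ))⁻¹ + (a ^ 2 * V l) ^ 2 * (√(n : ℝ))⁻¹ ^ 2) +
      ‖Complex.exp ((-(a ^ 2 * (((n / l : ℕ) : ℝ) / n * V l) / 2) : ℝ) : ℂ) -
        Complex.exp ((-(a ^ 2 * ((l : ℝ)⁻¹ * V l) / 2) : ℝ) : ℂ)‖) ?_ (fun l hl => ?_) fun l hl => ?_
  · have h2 := ((hcont.tendsto σ2).comp hVlim).sub_const (Complex.exp ((-(a ^ 2 * σ2 / 2) : ℝ) : ℂ))
    simpa using (hDlim.const_mul (4 * a ^ 2)).add h2.norm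
  · have h2 := ((hcont.tendsto _).comp ((tendsto_natDiv_div l hl).mul_const (V l))).sub_const
      (Complex.exp ((-(a ^ 2 * ((l : ℝ)⁻¹ * V l) / 2) : ℝ) : ℂ))
    simpa using ((hsqrt.const_mul (|a| * (l * B))).add ((hsqrt.const_mul ((|a| * (l * B)) ^ 3)).add
      ((hsqrt.pow 2).const_mul ((a ^ 2 * V l) ^ 2)))).add h2.norm
  have hev : ∀ᶠ n : ℕ in atTop, |a| * (l * B) * (√(n : ℝ))⁻¹ < 1 := by
    refine Tendsto.eventually_lt_const zero_lt_one ?_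
    simpa using hsqrt.const_mul (|a| * (l * B))
  filter_upwards [hev, eventually_ge_atTop 1] with n hn hn1
  have hnpos : (0 : ℝ) < n := by exact_mod_cast hn1
  have hspos : 0 < √(n : ℝ) := Real.sqrt_pos.2 hnpos
  have hlpos : (0 : ℝ) < l := by exact_mod_cast hl
  set s := (√(n : ℝ))⁻¹ with hs
  have hs0 : 0 < s := inv_pos.2 hspos
  have hns : (n : ℝ) * s ^ 2 = 1 := by
    rw [hs, inv_pow, Real.sq_sqrt hnpos.le, mul_inv_cancel₀ hnpos.ne']
  set u := a / √(n : ℝ) with hu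
  have hus : u = a * s := div_eq_mul_inv _ _
  have hu2 : u ^ 2 = a ^ 2 * s ^ 2 := by rw [hus, mul_pow]
  have hua : |u| = |a| * s := by rw [hus, abs_mul, abs_of_pos hs0]
  set m := n / l
  have hml : m * l ≤ n := Nat.div_mul_le_self n l
  have hmn : (m : ℝ) * l ≤ n := by exact_mod_cast hml
  set β : ℂ := Complex.exp ((-(u ^ 2 * V l / 2) : ℝ) : ℂ) with hβdef
  have hβ : ‖β‖ ≤ 1 := by
    rw [hβdef, Complex.norm_exp, Complex.ofReal_re, Real.exp_le_one_iff]
    have := mul_nonneg (sq_nonneg u) (hV0 l)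
    linarith
  have hβm : β ^ m = Complex.exp ((-(a ^ 2 * ((m : ℝ) / n * V l) / 2) : ℝ) : ℂ) := by
    rw [hβdef, ← Complex.exp_nat_mul]
    congr 1
    norm_cast
    rw [hu2, hs, inv_pow, Real.sq_sqrt hnpos.le]
    ring
  have hmean : ∫ ω, ∑ i ∈ Finset.range l, f (Z i ω) ∂μ = 0 := by
    rw [integral_finsetSum _ fun i _ => (h.memLp_comp hf i).integrable one_le_two]
    exact Finset.sum_eq_zero fun i _ => (h.integral_comp hfm i).trans h0
  have htaylor := norm_charFun_sub_gaussian_le (h.measurable_sum_comp hf (Finset.range l))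
    (M := l * B) (fun ω => by simpa using h.abs_sum_comp_le hf (Finset.range l) ω) hmean
    (u := u) (by rw [hua]; linarith)
  have hblocks := h.norm_charFun_blocks_sub_pow_le hsum hf u l hβ m
  have hrem : ‖∫ ω, Complex.exp (↑(u * ∑ i ∈ Finset.range n, f (Z i ω)) * Complex.I) ∂μ -
      ∫ ω, Complex.exp (↑(u * ∑ i ∈ Finset.range (m * l), f (Z i ω)) * Complex.I) ∂μ‖ ≤
      |a| * (l * B) * s := by
    rw [← integral_sub (h.integrable_exp_sum hf u _) (h.integrable_exp_sum hf u _)]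
    refine (norm_integral_le_of_norm_le_const (C := |a| * (l * B) * s)
      (ae_of_all _ fun ω => ?_)).trans (by simp)
    refine (norm_exp_ofReal_mul_I_sub_le _ _).trans ?_
    rw [← mul_sub, abs_mul, hua, ← Finset.sum_range_add_sum_Ico _ hml, add_sub_cancel_left]
    have hB : 0 ≤ B := (abs_nonneg _).trans (h.abs_comp_le hf 0 ω)
    have hcard : ((Finset.Ico (m * l) n).card : ℝ) ≤ l := by
      rw [Nat.card_Ico]
      have := Nat.div_add_mod' n l
      have := Nat.mod_lt n hl
      exact_mod_cast (by omega : n - n / l * l ≤ l)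
    have := (h.abs_sum_comp_le hf (Finset.Ico (m * l) n) ω).trans
      (mul_le_mul_of_nonneg_right hcard hB)
    calc |a| * s * _ ≤ |a| * s * (l * B) := by gcongr
      _ = |a| * (l * B) * s := by ring
  have hm1 : (m : ℝ) * s ^ 2 ≤ (l : ℝ)⁻¹ := by
    rw [← one_div, le_div_iff₀ hlpos, ← hns]
    linarith [mul_le_mul_of_nonneg_right hmn (sq_nonneg s)]
  have hm2 : (m : ℝ) * s ^ 2 ≤ 1 := by
    rw [← hns]
    gcongr
    exact Nat.div_le_self n l
  have hb1 : (m : ℝ) * (4 * u ^ 2 * D l) ≤ 4 * a ^ 2 * ((l : ℝ)⁻¹ * D l) := by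
    rw [hu2]
    have := mul_le_mul_of_nonneg_right hm1 (mul_nonneg (sq_nonneg a) (hD0 l))
    linarith
  have hb2 : (m : ℝ) * ((|u| * (l * B)) ^ 3 + (u ^ 2 * V l) ^ 2) ≤
      (|a| * (l * B)) ^ 3 * s + (a ^ 2 * V l) ^ 2 * s ^ 2 := by
    have hK : 0 ≤ (|a| * (l * B)) ^ 3 * s + (a ^ 2 * V l) ^ 2 * s ^ 2 := by
      have hB : 0 ≤ B := by
        obtain ⟨ω⟩ := μ.nonempty_of_neZero
        exact (abs_nonneg _).trans (h.abs_comp_le hf 0 ω)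
      positivity
    have := mul_le_mul_of_nonneg_right hm2 hK
    rw [hua, hu2]
    linarith
  have hb3 := mul_le_mul_of_nonneg_left htaylor (Nat.cast_nonneg (α := ℝ) m)
  have t1 := norm_sub_le_norm_sub_add_norm_sub
    (∫ ω, Complex.exp (↑(u * ∑ i ∈ Finset.range n, f (Z i ω)) * Complex.I) ∂μ)
    (∫ ω, Complex.exp (↑(u * ∑ i ∈ Finset.range (m * l), f (Z i ω)) * Complex.I) ∂μ)
    (Complex.exp ((-(a ^ 2 * σ2 / 2) : ℝ) : ℂ))
  have t2 := norm_sub_le_norm_sub_add_norm_sub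
    (∫ ω, Complex.exp (↑(u * ∑ i ∈ Finset.range (m * l), f (Z i ω)) * Complex.I) ∂μ) (β ^ m)
    (Complex.exp ((-(a ^ 2 * σ2 / 2) : ℝ) : ℂ))
  have t3 := norm_sub_le_norm_sub_add_norm_sub (β ^ m)
    (Complex.exp ((-(a ^ 2 * ((l : ℝ)⁻¹ * V l) / 2) : ℝ) : ℂ)) (Complex.exp ((-(a ^ 2 * σ2 / 2) : ℝ) : ℂ))
  rw [mul_add] at hblocks
  rw [hβm] at t2 t3 hblocks
  linarith

end BddAssocStationary

lemma tendstoStdGaussian_of_tendsto_charFun {μ : Measure Ω} [IsProbabilityMeasure μ]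
    {Y : ℕ → Ω → ℝ} (hY : ∀ n, Measurable (Y n))
    (h : ∀ t : ℝ, Tendsto (fun n => ∫ ω, Complex.exp (↑(t * Y n ω) * Complex.I) ∂μ) atTop
      (𝓝 (Complex.exp ((-(t ^ 2 / 2) : ℝ) : ℂ)))) : TendstoStdGaussian μ Y := by
  let P : ℕ → ProbabilityMeasure ℝ := fun n =>
    ⟨μ.map (Y n), Measure.isProbabilityMeasure_map (hY n).aemeasurable⟩
  let P₀ : ProbabilityMeasure ℝ := ⟨gaussianReal 0 1, inferInstance⟩
  have hP : Tendsto P atTop (𝓝 P₀) := by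
    refine ProbabilityMeasure.tendsto_of_tendsto_charFun fun t => ?_
    have e₀ : charFun (P₀ : Measure ℝ) t = Complex.exp ((-(t ^ 2 / 2) : ℝ) : ℂ) := by
      simp [P₀, charFun_gaussianReal]
    have e : ∀ n, charFun (P n : Measure ℝ) t =
        ∫ ω, Complex.exp (↑(t * Y n ω) * Complex.I) ∂μ := fun n => by
      rw [charFun_apply_real]
      change ∫ x, Complex.exp (t * x * Complex.I) ∂(μ.map (Y n)) = _
      rw [integral_map (hY n).aemeasurable (Measurable.aestronglyMeasurable (by fun_prop))]
      push_cast
      rfl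
    rw [e₀]
    exact (h t).congr fun n => (e n).symm
  intro g
  have := ProbabilityMeasure.tendsto_iff_forall_integral_tendsto.1 hP g
  refine this.congr fun n => ?_
  exact integral_map (hY n).aemeasurable g.continuous.aestronglyMeasurable

lemma IsAssociated.comp_embedding {μ : Measure Ω} {ι κ : Type*} {X : ι → Ω → ℝ}
    (h : IsAssociated μ X) (e : κ ↪ ι) : IsAssociated μ fun k => X (e k) := by
  intro S a b ha hb ma mb
  let φ : (↥(S.map e) → ℝ) → S → ℝ := fun x i => x ⟨e i, Finset.mem_map_of_mem e i.2⟩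
  have hφ : Monotone φ := fun x y hxy i => hxy _
  have mφ : Measurable φ := measurable_pi_lambda _ fun i => measurable_pi_apply _
  exact h (S.map e) (a ∘ φ) (b ∘ φ) (ha.comp hφ) (hb.comp hφ) (ma.comp mφ) (mb.comp mφ)

lemma abs_rho1_sub_le {μ : Measure Ω} [IsProbabilityMeasure μ] {Y : Ω → ℝ} (hY : Measurable Y)
    (hi : Integrable Y μ) (x y : ℝ) : |rho1 μ Y y - rho1 μ Y x| ≤ |y - x| := by
  have hint : ∀ z : ℝ, Integrable (fun ω => |z - Y ω|) μ := fun z =>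
    ((integrable_const z).sub hi).abs
  have hrho : ∀ z, rho1 μ Y z = ∫ ω, |z - Y ω| ∂μ := fun z =>
    integral_map hY.aemeasurable (Measurable.aestronglyMeasurable (by fun_prop))
  rw [hrho, hrho, ← integral_sub (hint y) (hint x)]
  rw [← Real.norm_eq_abs (∫ ω, _ ∂μ), ← mul_one |y - x|, ← probReal_univ (μ := μ)]
  refine norm_integral_le_of_norm_le_const (ae_of_all _ fun ω => ?_)
  refine (abs_abs_sub_abs_le_abs_sub _ _).trans_eq ?_
  congr 1
  ring

/-- Display (3.21) for the Gini kernel: the normalized linear part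
`n^{-1/2} ∑_{j=1}^n (ρ₁(X_j) − θ)/σ_U` converges in distribution to `N(0,1)`, where
`σ_U² = Var(ρ₁(X₁)) + 2 ∑_{j=1}^∞ Cov(ρ₁(X₁), ρ₁(X_{1+j}))`. -/
theorem gini_linear_part_clt (μ : Measure Ω) [IsProbabilityMeasure μ]
    (X : ℕ → Ω → ℝ) (hmeas : ∀ j, Measurable (X j))
    (hstat : StrictStationary μ X) (hassoc : IsAssociated μ X)
    (C₁ : ℝ) (hbdd : ∀ n : ℕ, 1 ≤ n → ∀ ω, |X n ω| ≤ C₁)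
    (hcovsum : Summable fun j : ℕ => cov μ (X 1) (X (j + 1)))
    (hcovpos : 0 < ∑' j : ℕ, cov μ (X 1) (X (j + 1)))
    (σU2 : ℝ)
    (hσU2 : σU2 = cov μ (fun ω => rho1 μ (X 1) (X 1 ω)) (fun ω => rho1 μ (X 1) (X 1 ω)) +
      2 * ∑' j : ℕ,
        cov μ (fun ω => rho1 μ (X 1) (X 1 ω)) (fun ω => rho1 μ (X 1) (X (j + 2) ω)))
    (hσUpos : 0 < σU2) :
    TendstoStdGaussian μ fun n ω =>
      (∑ j ∈ Finset.Icc 1 n, (rho1 μ (X 1) (X j ω) - giniTheta μ (X 1))) /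
        (Real.sqrt (n : ℝ) * Real.sqrt σU2) := by
  have hC : BddAssocStationary μ (fun i => X (i + 1)) C₁ :=
    { measurable := fun i => hmeas _
      bound := fun i => hbdd _ (Nat.le_add_left 1 i)
      assoc := hassoc.comp_embedding ⟨fun i => i + 1, add_left_injective 1⟩
      stationary := fun k n => by
        have := hstat k n
        simpa only [add_comm 1, add_right_comm] using this }
  have hL : ∀ i, MemLp (X (i + 1)) 2 μ := hC.memLp_comp (f := id) fun _ _ => le_rfl
  have hi1 : Integrable (X 1) μ := (hL 0).integrable one_le_two
  have hρ := abs_rho1_sub_le (hmeas 1) hi1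
  have hf : ∀ x y, |(rho1 μ (X 1) y - giniTheta μ (X 1)) - (rho1 μ (X 1) x - giniTheta μ (X 1))| ≤
      |y - x| := fun x y => by
    rw [sub_sub_sub_cancel_right]
    exact hρ x y
  have hρL : ∀ i, MemLp (fun ω => rho1 μ (X 1) (X (i + 1) ω)) 2 μ := hC.memLp_comp hρ
  have hρc : Continuous (rho1 μ (X 1)) :=
    continuous_of_abs_sub_le zero_le_one (by simpa using hρ)
  have h0 : ∫ ω, (rho1 μ (X 1) (X (0 + 1) ω) - giniTheta μ (X 1)) ∂μ = 0 := by
    rw [integral_sub ((hρL 0).integrable one_le_two) (integrable_const _), giniTheta,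
      integral_map (hmeas 1).aemeasurable hρc.aestronglyMeasurable]
    simp
  have hsum : Summable fun j => covariance (X (0 + 1)) (X (j + 1)) μ :=
    hcovsum.congr fun j => cov_eq_covariance (hL 0) (hL j)
  have hσ : σU2 = covariance (fun ω => rho1 μ (X 1) (X (0 + 1) ω) - giniTheta μ (X 1))
        (fun ω => rho1 μ (X 1) (X (0 + 1) ω) - giniTheta μ (X 1)) μ +
      2 * ∑' k, covariance (fun ω => rho1 μ (X 1) (X (0 + 1) ω) - giniTheta μ (X 1))
        (fun ω => rho1 μ (X 1) (X (k + 1 + 1) ω) - giniTheta μ (X 1)) μ := by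
    have hc : ∀ i j, covariance (fun ω => rho1 μ (X 1) (X (i + 1) ω) - giniTheta μ (X 1))
        (fun ω => rho1 μ (X 1) (X (j + 1) ω) - giniTheta μ (X 1)) μ =
        cov μ (fun ω => rho1 μ (X 1) (X (i + 1) ω)) (fun ω => rho1 μ (X 1) (X (j + 1) ω)) :=
      fun i j => by
        rw [covariance_sub_const_left ((hρL i).integrable one_le_two),
          covariance_sub_const_right ((hρL j).integrable one_le_two),
          cov_eq_covariance (hρL i) (hρL j)]
    simp only [hc]
    exact hσU2
  refine tendstoStdGaussian_of_tendsto_charFun (fun n => ?_) fun t => ?_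
  · exact (Finset.measurable_fun_sum _ fun j _ =>
      (hρc.measurable.comp (hmeas j)).sub_const _).div_const _
  have main := hC.tendsto_charFun hsum hf h0 hσ (t / √σU2)
  have hlim : (t / √σU2) ^ 2 * σU2 / 2 = t ^ 2 / 2 := by
    rw [div_pow, Real.sq_sqrt hσUpos.le, div_mul_cancel₀ _ hσUpos.ne']
  rw [hlim] at main
  refine main.congr fun n => ?_
  congr! 5 with ω
  rw [Finset.range_eq_Ico, Finset.sum_Ico_add' (fun j => rho1 μ (X 1) (X j ω) - giniTheta μ (X 1)),
    zero_add, Finset.Ico_add_one_right_eq_Icc]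
  ring
end
end
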